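/- Let U be a C²(ℝ²) stable solution of ΔU + f(U) = 0 in ℝ² with 0 ≤ U ≤ 1. Then either U ≡ 0 in ℝ² or U ≡ 1 in ℝ². -/

import Mathlib

open Set Filter Topology MeasureTheory

noncomputable section

/-- `ℝ^N` with `N = d+1`, Euclidean structure. -/
abbrev Euc (d : ℕ) := EuclideanSpace ℝ (Fin (d + 1))

/-- The Euclidean norm of `x' = (x₂,…,x_N)` for `x = (x₁,x') ∈ ℝ^N`. -/
def primeNorm {d : ℕ} (x : Euc d) : ℝ :=
  Real.sqrt (∑ i, if i = 0 then 0 else (x i) ^ 2)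

/-- The funnel-shaped domain `Ω = {x : |x'| < h(x₁)}`. -/
def funnel (d : ℕ) (h : ℝ → ℝ) : Set (Euc d) := {x | primeNorm x < h (x 0)}

/-- The Laplacian of `g` at `x`, computed with derivatives taken within the set `s`. -/
def lapW {d : ℕ} (s : Set (Euc d)) (g : Euc d → ℝ) (x : Euc d) : ℝ :=
  ∑ i, fderivWithin ℝ (fun y => fderivWithin ℝ g s y (EuclideanSpace.single i 1)) s x
      (EuclideanSpace.single i 1)

/-- The quantity `ν·∇g` at a boundary point `x` of the funnel domain `Ω_{R,α}`, where
`ν(x) = (1+h'(x₁)²)^{-1/2}·(-h'(x₁), x'/|x'|)` is the outward unit normal. -/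
def neumannLHS {d : ℕ} (h : ℝ → ℝ) (g : Euc d → ℝ) (x : Euc d) : ℝ :=
  (Real.sqrt (1 + deriv h (x 0) ^ 2))⁻¹ *
    (-(deriv h (x 0)) * fderivWithin ℝ g (closure (funnel d h)) x (EuclideanSpace.single 0 1)
      + ∑ i, if i = 0 then 0 else
          (x i / primeNorm x) *
            fderivWithin ℝ g (closure (funnel d h)) x (EuclideanSpace.single i 1))

/-- The bistable nonlinearity `f`, of class `C^{1,1}`, with positive mass, extended affinely
outside `[0,1]`. -/
structure Bistable (f : ℝ → ℝ) (θ : ℝ) : Prop where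
  smooth : ContDiff ℝ 1 f
  lip_deriv : ∃ C : NNReal, LipschitzWith C (deriv f)
  f0 : f 0 = 0
  f1 : f 1 = 0
  df0 : deriv f 0 < 0
  df1 : deriv f 1 < 0
  θmem : θ ∈ Ioo (0 : ℝ) 1
  neg : ∀ s ∈ Ioo (0 : ℝ) θ, f s < 0
  pos : ∀ s ∈ Ioo θ (1 : ℝ), 0 < f s
  dθ : 0 < deriv f θ
  mass : 0 < ∫ s in (0 : ℝ)..1, f s
  ext_neg : ∀ s < (0 : ℝ), f s = deriv f 0 * s
  ext_pos : ∀ s > (1 : ℝ), f s = deriv f 1 * (s - 1)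

/-- The planar traveling front `φ(x₁ - ct)`: `φ'' + cφ' + f(φ) = 0`, `φ(-∞) = 1`,
`φ(+∞) = 0`, `0 < φ < 1`, `φ` decreasing, normalized by `φ(0) = θ`, with speed `c > 0`. -/
structure PlanarFront (f : ℝ → ℝ) (θ c : ℝ) (φ : ℝ → ℝ) : Prop where
  cpos : 0 < c
  mem : ∀ z : ℝ, φ z ∈ Ioo (0 : ℝ) 1
  smooth : ContDiff ℝ 2 φ
  anti : StrictAnti φ
  ode : ∀ z : ℝ, deriv (deriv φ) z + c * deriv φ z + f (φ z) = 0
  lim_bot : Tendsto φ atBot (nhds 1)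
  lim_top : Tendsto φ atTop (nhds 0)
  pin : φ 0 = θ

/-- `h : ℝ → ℝ` defines a funnel-shaped domain `Ω_{R,α}` (of dimension `N = d+1 ≥ 2`) with
cylinder radius `R`, opening angle `α` and transition parameter `L`. -/
structure IsFunnel (d : ℕ) (R α L : ℝ) (h : ℝ → ℝ) : Prop where
  dpos : 1 ≤ d
  Rpos : 0 < R
  αmem : α ∈ Ico (0 : ℝ) (Real.pi / 2)
  RL : R < L
  smooth : ContDiff ℝ 2 h
  holder : ∃ β : NNReal, 0 < β ∧ (β : ℝ) < 1 ∧ ∃ C : NNReal, HolderWith C β (deriv (deriv h))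
  deriv_nonneg : ∀ x : ℝ, 0 ≤ deriv h x
  deriv_le : ∀ x : ℝ, deriv h x ≤ Real.tan α
  left : ∀ x ≤ (0 : ℝ), h x = R
  right : ∀ x : ℝ, L * Real.cos α ≤ x → h x = x * Real.tan α

/-- An entire solution of `u_t = Δu + f(u)` in `ℝ × Ω̄` (with values in `[0,1]`),
Neumann boundary condition `ν·∇u = 0` on `ℝ × ∂Ω`, emanating from the planar front
`φ(x₁ - ct)` as `t → -∞`. -/
structure IsEntireSolution (d : ℕ) (h f : ℝ → ℝ) (c : ℝ) (φ : ℝ → ℝ)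
    (u : ℝ → Euc d → ℝ) : Prop where
  range01 : ∀ t : ℝ, ∀ x ∈ closure (funnel d h), u t x ∈ Icc (0 : ℝ) 1
  time_diff : ∀ x ∈ closure (funnel d h), Differentiable ℝ fun t => u t x
  space_reg : ∀ t : ℝ, ContDiffOn ℝ 2 (u t) (closure (funnel d h))
  pde : ∀ t : ℝ, ∀ x ∈ closure (funnel d h),
      deriv (fun s => u s x) t = lapW (closure (funnel d h)) (u t) x + f (u t x)
  neumann : ∀ t : ℝ, ∀ x ∈ frontier (funnel d h), neumannLHS h (u t) x = 0
  past : ∀ ε > (0 : ℝ), ∃ T : ℝ, ∀ t ≤ T, ∀ x ∈ closure (funnel d h),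
      |u t x - φ (x 0 - c * t)| ≤ ε

/-- Complete propagation: `u(t,x) → 1` as `t → +∞` locally uniformly in `x ∈ Ω̄`. -/
def CompletePropagation (d : ℕ) (h : ℝ → ℝ) (u : ℝ → Euc d → ℝ) : Prop :=
  TendstoLocallyUniformlyOn u (fun _ => (1 : ℝ)) atTop (closure (funnel d h))

/-- Blocking: `u(t,·)` converges uniformly on `Ω̄`, as `t → +∞`, to a stationary solution
`u_∞` with `u_∞(x) → 0` as `x₁ → +∞`. -/
def Blocked (d : ℕ) (h f : ℝ → ℝ) (u : ℝ → Euc d → ℝ) : Prop :=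
  ∃ uinf : Euc d → ℝ,
    TendstoUniformlyOn u uinf atTop (closure (funnel d h)) ∧
    ContDiffOn ℝ 2 uinf (closure (funnel d h)) ∧
    (∀ x ∈ closure (funnel d h), lapW (closure (funnel d h)) uinf x + f (uinf x) = 0) ∧
    (∀ x ∈ frontier (funnel d h), neumannLHS h uinf x = 0) ∧
    (∀ ε > (0 : ℝ), ∃ A : ℝ, ∀ x ∈ closure (funnel d h), A ≤ x 0 → |uinf x| ≤ ε)

/-- Stability of a solution `U` of `ΔU + f(U) = 0` on `s̄`:
`∫_s (|∇ψ|² - f'(U)ψ²) ≥ 0` for all compactly supported `C¹` functions `ψ`. -/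
def StableOn {d : ℕ} (s : Set (Euc d)) (f : ℝ → ℝ) (U : Euc d → ℝ) : Prop :=
  ∀ ψ : Euc d → ℝ, ContDiff ℝ 1 ψ → HasCompactSupport ψ →
    0 ≤ ∫ x in s, (‖gradient ψ x‖ ^ 2 - deriv f (U x) * ψ x ^ 2)

/-- The `i`-th partial derivative of a function on the plane. -/
def pd (i : Fin 2) (g : Euc 1 → ℝ) (x : Euc 1) : ℝ :=
  fderiv ℝ g x (EuclideanSpace.single i 1)

lemma ContDiff.pd {n : WithTop ℕ∞} {g : Euc 1 → ℝ} (hg : ContDiff ℝ (n + 1) g) (i : Fin 2) :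
    ContDiff ℝ n (pd i g) :=
  (hg.fderiv_right le_rfl).clm_apply contDiff_const

lemma ContDiff.continuous_pd {g : Euc 1 → ℝ} (hg : ContDiff ℝ 1 g) (i : Fin 2) :
    Continuous (_root_.pd i g) :=
  (ContDiff.pd (n := 0) (by simpa using hg) i).continuous

lemma fderiv_apply_eq_pd (g : Euc 1 → ℝ) (x v : Euc 1) :
    fderiv ℝ g x v = v 0 * pd 0 g x + v 1 * pd 1 g x := by
  have hv : v = v 0 • EuclideanSpace.single 0 1 + v 1 • EuclideanSpace.single 1 1 := by
    ext i
    fin_cases i <;> simp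
  conv_lhs => rw [hv]
  simp [pd]

lemma norm_gradient_sq (g : Euc 1 → ℝ) (x : Euc 1) :
    ‖gradient g x‖ ^ 2 = pd 0 g x ^ 2 + pd 1 g x ^ 2 := by
  have h : ∀ i : Fin 2, gradient g x i = pd i g x := by
    intro i
    have := InnerProductSpace.toDual_symm_apply (𝕜 := ℝ)
      (x := EuclideanSpace.single (i : Fin (1 + 1)) (1 : ℝ)) (y := fderiv ℝ g x)
    rw [EuclideanSpace.inner_single_right] at this
    simpa [gradient, pd] using this
  rw [EuclideanSpace.norm_sq_eq, Fin.sum_univ_two]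
  simp [h]

lemma pd_mul {g h : Euc 1 → ℝ} (hg : Differentiable ℝ g) (hh : Differentiable ℝ h) (i : Fin 2)
    (x : Euc 1) : pd i (fun y => g y * h y) x = g x * pd i h x + h x * pd i g x := by
  simp [pd, fderiv_fun_mul (hg x) (hh x)]

lemma pd_add {g h : Euc 1 → ℝ} (hg : Differentiable ℝ g) (hh : Differentiable ℝ h) (i : Fin 2)
    (x : Euc 1) : pd i (fun y => g y + h y) x = pd i g x + pd i h x := by
  simp [pd, fderiv_fun_add (hg x) (hh x)]

lemma pd_const_mul {g : Euc 1 → ℝ} (hg : Differentiable ℝ g) (c : ℝ) (i : Fin 2)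
    (x : Euc 1) : pd i (fun y => c * g y) x = c * pd i g x := by
  simp [pd, fderiv_const_mul (hg x) c]

lemma pd_comp {φ : ℝ → ℝ} {g : Euc 1 → ℝ} (hφ : Differentiable ℝ φ) (hg : Differentiable ℝ g)
    (i : Fin 2) (x : Euc 1) : pd i (fun y => φ (g y)) x = deriv φ (g x) * pd i g x := by
  have := (hφ (g x)).hasDerivAt.comp_hasFDerivAt x (hg x).hasFDerivAt
  have h2 : fderiv ℝ (fun y => φ (g y)) x = deriv φ (g x) • fderiv ℝ g x := this.fderiv
  simp [pd, h2]

lemma pd_of_eventuallyEq {g h : Euc 1 → ℝ} {x : Euc 1} (hgh : g =ᶠ[𝓝 x] h) (i : Fin 2) :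
    pd i g x = pd i h x := by
  simp [pd, hgh.fderiv_eq]

lemma HasCompactSupport.pd {g : Euc 1 → ℝ} (hg : HasCompactSupport g) (i : Fin 2) :
    HasCompactSupport (pd i g) :=
  hg.fderiv_apply ℝ _

lemma pd_symm {U : Euc 1 → ℝ} (hU : ContDiff ℝ 2 U) (i j : Fin 2) (x : Euc 1) :
    pd i (pd j U) x = pd j (pd i U) x := by
  have hs := (hU.contDiffAt (x := x)).isSymmSndFDerivAt (by simp)
  have hd : DifferentiableAt ℝ (fderiv ℝ U) x :=
    ((hU.fderiv_right (m := 1) (by norm_num)).differentiable (by norm_num)) x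
  have h : ∀ k l : Fin 2, _root_.pd k (_root_.pd l U) x =
      fderiv ℝ (fderiv ℝ U) x (EuclideanSpace.single k 1) (EuclideanSpace.single l 1) := by
    intro k l
    have := hd.hasFDerivAt.clm_apply
      (hasFDerivAt_const (EuclideanSpace.single l (1 : ℝ) : Euc 1) x)
    have h2 : fderiv ℝ (_root_.pd l U) x = _ := this.fderiv
    rw [_root_.pd, h2]
    simp
  rw [h, h]
  exact hs _ _

lemma lapW_univ (U : Euc 1 → ℝ) (x : Euc 1) :
    lapW Set.univ U x = pd 0 (pd 0 U) x + pd 1 (pd 1 U) x := by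
  simp [lapW, fderivWithin_univ, Fin.sum_univ_two, pd]
  rfl

lemma integral_mul_pd {g φ : Euc 1 → ℝ} (hg : ContDiff ℝ 1 g) (hφ : ContDiff ℝ 1 φ)
    (hc : HasCompactSupport φ) (i : Fin 2) :
    ∫ x, g x * pd i φ x = -∫ x, pd i g x * φ x := by
  refine integral_mul_fderiv_eq_neg_fderiv_mul_of_integrable ?_ ?_ ?_
    (fun x _ => hg.differentiable one_ne_zero x) (fun x _ => hφ.differentiable one_ne_zero x)
  · exact ((hg.continuous_pd i).mul hφ.continuous).integrable_of_hasCompactSupport hc.mul_left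
  · exact (hg.continuous.mul (hφ.continuous_pd i)).integrable_of_hasCompactSupport
      (hc.pd i).mul_left
  · exact (hg.continuous.mul hφ.continuous).integrable_of_hasCompactSupport hc.mul_left

/-- Differentiation under the integral sign for a correlation with a compactly supported kernel. -/
lemma hasDerivAt_integral_shift {T Φ : Euc 1 → ℝ} (hT : ContDiff ℝ 1 T) (hΦ : Continuous Φ)
    (hc : HasCompactSupport Φ) (i : Fin 2) :
    HasDerivAt (fun h : ℝ => ∫ x, T (x + h • EuclideanSpace.single i 1) * Φ x)
      (∫ x, pd i T x * Φ x) 0 := by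
  have hcont : Continuous fun q : ℝ × Euc 1 => pd i T (q.2 + q.1 • EuclideanSpace.single i 1) :=
    (hT.continuous_pd i).comp (by fun_prop)
  obtain ⟨M, hM⟩ := ((isCompact_Icc (a := (-1 : ℝ)) (b := 1)).prod
    hc.isCompact).exists_bound_of_continuousOn hcont.continuousOn
  have key := hasDerivAt_integral_of_dominated_loc_of_deriv_le (μ := (volume : Measure (Euc 1)))
    (F := fun (h : ℝ) x => T (x + h • EuclideanSpace.single i 1) * Φ x)
    (F' := fun (h : ℝ) x => pd i T (x + h • EuclideanSpace.single i 1) * Φ x)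
    (x₀ := 0) (s := Icc (-1) 1) (bound := fun x => M * |Φ x|)
    (Icc_mem_nhds (by norm_num) (by norm_num)) ?_ ?_ ?_ ?_ ?_ ?_
  · simpa using key.2
  · refine Eventually.of_forall fun h => Continuous.aestronglyMeasurable ?_
    exact (hT.continuous.comp (by fun_prop)).mul hΦ
  · refine Continuous.integrable_of_hasCompactSupport ?_ hc.mul_left
    exact (hT.continuous.comp (by fun_prop)).mul hΦ
  · refine Continuous.aestronglyMeasurable ?_
    exact ((hT.continuous_pd i).comp (by fun_prop)).mul hΦ
  · refine Eventually.of_forall fun x h hh => ?_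
    rw [norm_mul, Real.norm_eq_abs (Φ x)]
    by_cases hx : Φ x = 0
    · simp [hx]
    · exact mul_le_mul_of_nonneg_right (hM (h, x) ⟨hh, subset_tsupport _ hx⟩) (abs_nonneg _)
  · exact (Continuous.integrable_of_hasCompactSupport hΦ.abs
      (hc.comp_left (g := fun t : ℝ => |t|) abs_zero)).const_mul M
  · refine Eventually.of_forall fun x h _ => HasDerivAt.mul_const ?_ _
    have h1 : HasDerivAt (fun h : ℝ => x + h • (EuclideanSpace.single i 1 : Euc 1))
        (EuclideanSpace.single i 1) h := by
      simpa using ((hasDerivAt_id h).smul_const (EuclideanSpace.single i 1 : Euc 1)).const_add x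
    exact (hT.differentiable one_ne_zero _).hasFDerivAt.comp_hasDerivAt h h1

lemma integral_pd_mul_pd {f : ℝ → ℝ} {U : Euc 1 → ℝ} (hU : ContDiff ℝ 2 U)
    (hpde : ∀ x, pd 0 (pd 0 U) x + pd 1 (pd 1 U) x + f (U x) = 0)
    {φ : Euc 1 → ℝ} (hφ : ContDiff ℝ 1 φ) (hc : HasCompactSupport φ) :
    (∫ x, pd 0 U x * pd 0 φ x) + ∫ x, pd 1 U x * pd 1 φ x = ∫ x, f (U x) * φ x := by
  have hUi : ∀ i, ContDiff ℝ 1 (pd i U) := fun i => ContDiff.pd (n := 1) (by norm_num; exact hU) i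
  rw [integral_mul_pd (hUi 0) hφ hc, integral_mul_pd (hUi 1) hφ hc, ← neg_add, ← integral_add,
    ← integral_neg]
  · refine integral_congr_ae (Eventually.of_forall fun x => ?_)
    have := hpde x
    simp only
    linear_combination (-φ x) * this
  all_goals
    exact (((hUi _).continuous_pd _).mul hφ.continuous).integrable_of_hasCompactSupport hc.mul_left

/-- The linearized equation, in weak form, satisfied by the partial derivatives of a solution. -/
lemma integral_pd_pd_mul_pd {f : ℝ → ℝ} (hf : ContDiff ℝ 1 f) {U : Euc 1 → ℝ}
    (hU : ContDiff ℝ 2 U)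
    (hpde : ∀ x, pd 0 (pd 0 U) x + pd 1 (pd 1 U) x + f (U x) = 0)
    {φ : Euc 1 → ℝ} (hφ : ContDiff ℝ 1 φ) (hc : HasCompactSupport φ) (i : Fin 2) :
    (∫ x, pd i (pd 0 U) x * pd 0 φ x) + ∫ x, pd i (pd 1 U) x * pd 1 φ x =
      ∫ x, deriv f (U x) * pd i U x * φ x := by
  have hUi : ∀ i, ContDiff ℝ 1 (pd i U) := fun i => ContDiff.pd (n := 1) (by norm_num; exact hU) i
  have hU1 : ContDiff ℝ 1 U := hU.of_le (by norm_num)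
  have hd := (hasDerivAt_integral_shift (hUi 0) (hφ.continuous_pd 0) (hc.pd 0) i).add
    (hasDerivAt_integral_shift (hUi 1) (hφ.continuous_pd 1) (hc.pd 1) i)
  have hr := hasDerivAt_integral_shift (hf.comp hU1) hφ.continuous hc i
  have hshift : ∀ h : ℝ, ∀ G φ : Euc 1 → ℝ,
      ∫ x, G (x + h • EuclideanSpace.single i 1) * φ x =
        ∫ x, G x * φ (x - h • EuclideanSpace.single i 1) := by
    intro h G φ
    rw [← integral_add_right_eq_self (fun x => G x * φ (x - h • EuclideanSpace.single i 1))
      (h • (EuclideanSpace.single i 1 : Euc 1))]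
    simp
  have heq : ((fun h : ℝ => ∫ x, pd 0 U (x + h • EuclideanSpace.single i 1) * pd 0 φ x) +
      fun h : ℝ => ∫ x, pd 1 U (x + h • EuclideanSpace.single i 1) * pd 1 φ x) =
      fun h : ℝ => ∫ x, (f ∘ U) (x + h • EuclideanSpace.single i 1) * φ x := by
    funext h
    simp only [Pi.add_apply]
    rw [hshift, hshift, hshift]
    have hsub : ∀ j : Fin 2, ∀ x : Euc 1, pd j φ (x - h • EuclideanSpace.single i 1) =
        pd j (fun y => φ (y - h • EuclideanSpace.single i 1)) x := by
      intro j x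
      simp [pd, sub_eq_add_neg, fderiv_comp_add_right]
    simp only [hsub]
    refine integral_pd_mul_pd hU hpde (hφ.comp (contDiff_id.sub contDiff_const)) ?_
    have := hc.comp_homeomorph (Homeomorph.addRight (-(h • (EuclideanSpace.single i 1 : Euc 1))))
    simpa [Function.comp_def, sub_eq_add_neg] using this
  rw [heq] at hd
  rw [hd.unique hr]
  refine integral_congr_ae (Eventually.of_forall fun x => ?_)
  have := pd_comp (hf.differentiable one_ne_zero) (hU1.differentiable one_ne_zero) i x
  simp only [Function.comp_def]
  rw [this]

lemma integrable_fun_sub {g h : Euc 1 → ℝ} (hg : Integrable g) (hh : Integrable h) :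
    Integrable fun x => g x - h x :=
  hg.sub hh

lemma pd_eq_zero_of_notMem_tsupport {η : Euc 1 → ℝ} {x : Euc 1} (hx : x ∉ tsupport η)
    (i : Fin 2) : pd i η x = 0 := by
  rw [pd_of_eventuallyEq (notMem_tsupport_iff_eventuallyEq.1 hx) i]
  simp [pd]

lemma integrable_of_cutoff {g η : Euc 1 → ℝ} (hc : HasCompactSupport η) (hg : Continuous g)
    (h : ∀ x, η x = 0 → pd 0 η x = 0 → pd 1 η x = 0 → g x = 0) : Integrable g :=
  hg.integrable_of_hasCompactSupport <| HasCompactSupport.intro hc fun x hx =>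
    h x (image_eq_zero_of_notMem_tsupport hx) (pd_eq_zero_of_notMem_tsupport hx 0)
      (pd_eq_zero_of_notMem_tsupport hx 1)

lemma ContDiff.pd_one {U : Euc 1 → ℝ} (hU : ContDiff ℝ 2 U) (i : Fin 2) :
    ContDiff ℝ 1 (_root_.pd i U) :=
  ContDiff.pd (n := 1) (by norm_num; exact hU) i

lemma integral_weak_eq_zero {f : ℝ → ℝ} (hf : ContDiff ℝ 1 f) {U : Euc 1 → ℝ}
    (hU : ContDiff ℝ 2 U)
    (hpde : ∀ x, pd 0 (pd 0 U) x + pd 1 (pd 1 U) x + f (U x) = 0)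
    {φ : Euc 1 → ℝ} (hφ : ContDiff ℝ 1 φ) (hc : HasCompactSupport φ) :
    ∫ x, (pd 0 U x * pd 0 φ x + pd 1 U x * pd 1 φ x - f (U x) * φ x) = 0 := by
  have h := integral_pd_mul_pd hU hpde hφ hc
  have i0 := (hU.pd_one 0).continuous
  have i1 := (hU.pd_one 1).continuous
  have j0 := hφ.continuous_pd 0
  have j1 := hφ.continuous_pd 1
  rw [integral_sub, integral_add, h, sub_self]
  · exact integrable_of_cutoff hc (by fun_prop) (by intro x; simp +contextual)
  · exact integrable_of_cutoff hc (by fun_prop) (by intro x; simp +contextual)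
  · exact integrable_of_cutoff hc (by fun_prop) (by intro x; simp +contextual)
  · have := hf.continuous.comp hU.continuous
    exact integrable_of_cutoff hc (this.mul hφ.continuous) (by intro x; simp +contextual)

lemma integral_linearized_eq_zero {f : ℝ → ℝ} (hf : ContDiff ℝ 1 f) {U : Euc 1 → ℝ}
    (hU : ContDiff ℝ 2 U)
    (hpde : ∀ x, pd 0 (pd 0 U) x + pd 1 (pd 1 U) x + f (U x) = 0)
    {φ : Euc 1 → ℝ} (hφ : ContDiff ℝ 1 φ) (hc : HasCompactSupport φ) (i : Fin 2) :
    Integrable (fun x => pd 0 (pd i U) x * pd 0 φ x + pd 1 (pd i U) x * pd 1 φ x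
      - deriv f (U x) * pd i U x * φ x) ∧
    ∫ x, (pd 0 (pd i U) x * pd 0 φ x + pd 1 (pd i U) x * pd 1 φ x
      - deriv f (U x) * pd i U x * φ x) = 0 := by
  have h := integral_pd_pd_mul_pd hf hU hpde hφ hc i
  simp only [pd_symm hU i] at h
  have i0 := (hU.pd_one i).continuous_pd 0
  have i1 := (hU.pd_one i).continuous_pd 1
  have j0 := hφ.continuous_pd 0
  have j1 := hφ.continuous_pd 1
  have k1 : Integrable fun x => pd 0 (pd i U) x * pd 0 φ x + pd 1 (pd i U) x * pd 1 φ x :=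
    integrable_of_cutoff hc (by fun_prop) (by intro x; simp +contextual)
  have k2 : Integrable fun x => deriv f (U x) * pd i U x * φ x := by
    have h1 := (hf.continuous_deriv le_rfl).comp hU.continuous
    have h2 := (hU.pd_one i).continuous
    exact integrable_of_cutoff hc ((h1.mul h2).mul hφ.continuous) (by intro x; simp +contextual)
  refine ⟨k1.sub k2, ?_⟩
  rw [integral_sub k1 k2, integral_add, h, sub_self]
  · exact integrable_of_cutoff hc (by fun_prop) (by intro x; simp +contextual)
  · exact integrable_of_cutoff hc (by fun_prop) (by intro x; simp +contextual)

/-- Caccioppoli-type estimate for bounded solutions. -/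
lemma integral_energy_le {f : ℝ → ℝ} (hf : ContDiff ℝ 1 f) {U : Euc 1 → ℝ}
    (hU : ContDiff ℝ 2 U) (hrange : ∀ x, U x ∈ Icc (0 : ℝ) 1)
    (hpde : ∀ x, pd 0 (pd 0 U) x + pd 1 (pd 1 U) x + f (U x) = 0)
    {M : ℝ} (hM : ∀ x, |f (U x)| ≤ M)
    {η : Euc 1 → ℝ} (hη : ContDiff ℝ 1 η) (hc : HasCompactSupport η) :
    ∫ x, (pd 0 U x ^ 2 + pd 1 U x ^ 2) * η x ^ 2 ≤
      ∫ x, (4 * (pd 0 η x ^ 2 + pd 1 η x ^ 2) + 2 * M * η x ^ 2) := by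
  have hU1 : ContDiff ℝ 1 U := hU.of_le (by norm_num)
  have dU := hU1.differentiable one_ne_zero
  have dη := hη.differentiable one_ne_zero
  have hφ : ContDiff ℝ 1 (fun x => U x * (η x * η x)) := hU1.mul (hη.mul hη)
  have hφc : HasCompactSupport (fun x => U x * (η x * η x)) := (hc.mul_left (f := η)).mul_left
  have hw := integral_weak_eq_zero hf hU hpde hφ hφc
  have hp : ∀ i x, pd i (fun x => U x * (η x * η x)) x =
      U x * (2 * η x * pd i η x) + η x ^ 2 * pd i U x := by
    intro i x
    rw [pd_mul dU (dη.fun_mul dη), pd_mul dη dη]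
    ring
  simp only [hp] at hw
  have i0 := (hU.pd_one 0).continuous
  have i1 := (hU.pd_one 1).continuous
  have j0 := hη.continuous_pd 0
  have j1 := hη.continuous_pd 1
  have cη := hη.continuous
  have cU := hU.continuous
  have cf := hf.continuous.comp hU.continuous
  have e1 : Integrable fun x => (pd 0 U x ^ 2 + pd 1 U x ^ 2) * η x ^ 2 :=
    integrable_of_cutoff hc (by fun_prop) (by intro x; simp +contextual)
  have e2 : Integrable fun x => 4 * (pd 0 η x ^ 2 + pd 1 η x ^ 2) + 2 * M * η x ^ 2 :=
    integrable_of_cutoff hc (by fun_prop) (by intro x; simp +contextual)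
  have e3 : Integrable fun x => pd 0 U x * (U x * (2 * η x * pd 0 η x) + η x ^ 2 * pd 0 U x)
      + pd 1 U x * (U x * (2 * η x * pd 1 η x) + η x ^ 2 * pd 1 U x)
      - f (U x) * (U x * (η x * η x)) := by
    refine integrable_of_cutoff hc ?_ (by intro x; simp +contextual)
    exact Continuous.sub (by fun_prop) (cf.mul (by fun_prop))
  have key : ∫ x, (pd 0 U x ^ 2 + pd 1 U x ^ 2) * η x ^ 2 ≤
      ∫ x, ((4 * (pd 0 η x ^ 2 + pd 1 η x ^ 2) + 2 * M * η x ^ 2) +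
        2 * (pd 0 U x * (U x * (2 * η x * pd 0 η x) + η x ^ 2 * pd 0 U x)
      + pd 1 U x * (U x * (2 * η x * pd 1 η x) + η x ^ 2 * pd 1 U x)
      - f (U x) * (U x * (η x * η x)))) := by
    refine integral_mono e1 (e2.add (e3.const_mul 2)) fun x => ?_
    simp only
    obtain ⟨h0, h1⟩ := hrange x
    have hfM := abs_le.1 (hM x)
    have hUf : f (U x) * U x ≤ M := by
      have : 0 ≤ M := (abs_nonneg _).trans (hM x)
      nlinarith
    have hU2 : U x ^ 2 ≤ 1 := by nlinarith
    have s0 := mul_nonneg (sub_nonneg.2 hU2) (sq_nonneg (pd 0 η x))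
    have s1 := mul_nonneg (sub_nonneg.2 hU2) (sq_nonneg (pd 1 η x))
    have s2 := mul_nonneg (sub_nonneg.2 hUf) (sq_nonneg (η x))
    nlinarith [sq_nonneg (η x * pd 0 U x + 2 * U x * pd 0 η x),
      sq_nonneg (η x * pd 1 U x + 2 * U x * pd 1 η x)]
  rw [integral_add e2 (e3.const_mul 2), integral_const_mul, hw] at key
  simpa using key

/-- The sum of the squared `2 × 2` minors of the Jacobian of `(U₀, U₁, κ)` against the vector
`(U₀, U₁, κ)`, normalized; here `U₀, U₁` are the partial derivatives of `U`. -/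
def defect (U κ : Euc 1 → ℝ) (x : Euc 1) : ℝ :=
  (∑ j : Fin 2, ((pd 0 U x * pd j (pd 1 U) x - pd 1 U x * pd j (pd 0 U) x) ^ 2 +
    (pd 0 U x * pd j κ x - κ x * pd j (pd 0 U) x) ^ 2 +
    (pd 1 U x * pd j κ x - κ x * pd j (pd 1 U) x) ^ 2)) /
      (pd 0 U x ^ 2 + pd 1 U x ^ 2 + κ x ^ 2)

lemma defect_nonneg (U κ : Euc 1 → ℝ) (x : Euc 1) : 0 ≤ defect U κ x := by
  unfold defect
  positivity

lemma continuous_defect {U κ : Euc 1 → ℝ} (hU : ContDiff ℝ 2 U) (hκ : ContDiff ℝ 1 κ)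
    (hpos : ∀ x, 0 < κ x) : Continuous (defect U κ) := by
  have i0 := (hU.pd_one 0).continuous
  have i1 := (hU.pd_one 1).continuous
  have cκ := hκ.continuous
  refine Continuous.div ?_ (by fun_prop) fun x => ?_
  · refine continuous_finsetSum _ fun j _ => ?_
    have k0 := (hU.pd_one 0).continuous_pd j
    have k1 := (hU.pd_one 1).continuous_pd j
    have k2 := hκ.continuous_pd j
    fun_prop
  · have := hpos x
    positivity

lemma sq_deriv_cutoff_mul_eq {a b c a' b' c' η η' w w' : ℝ} (hw : w ^ 2 = a ^ 2 + b ^ 2 + c ^ 2)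
    (hw0 : 0 < w) (hw' : w * w' = a * a' + b * b' + c * c') :
    (η * w' + w * η') ^ 2 = (a ^ 2 + b ^ 2) * η' ^ 2 + (η * c' + c * η') ^ 2
      + (a' * (a * (2 * η * η') + η ^ 2 * a') + b' * (b * (2 * η * η') + η ^ 2 * b'))
      - η ^ 2 * (((a * b' - b * a') ^ 2 + (a * c' - c * a') ^ 2 + (b * c' - c * b') ^ 2) /
        (a ^ 2 + b ^ 2 + c ^ 2)) := by
  rw [← hw]
  field_simp
  have h2 : w ^ 2 * w' ^ 2 = (a * a' + b * b' + c * c') ^ 2 := by rw [← hw']; ring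
  have hww : w ^ 2 - (a ^ 2 + b ^ 2 + c ^ 2) = 0 := by rw [hw]; ring
  linear_combination (η ^ 2) * h2 + (2 * w ^ 2 * η * η') * hw'
    + (w ^ 2 * η' ^ 2 - η ^ 2 * (a' ^ 2 + b' ^ 2 + c' ^ 2)) * hww

/-- Stability tested against `η √(|∇U|² + κ²)`. -/
lemma integral_cutoff_defect_le {f : ℝ → ℝ} (hf : ContDiff ℝ 1 f) {U : Euc 1 → ℝ}
    (hU : ContDiff ℝ 2 U)
    (hpde : ∀ x, pd 0 (pd 0 U) x + pd 1 (pd 1 U) x + f (U x) = 0)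
    (hstable : StableOn Set.univ f U)
    {κ : Euc 1 → ℝ} (hκ : ContDiff ℝ 1 κ) (hpos : ∀ x, 0 < κ x)
    {η : Euc 1 → ℝ} (hη : ContDiff ℝ 1 η) (hc : HasCompactSupport η) :
    ∫ x, η x ^ 2 * defect U κ x ≤
      (∫ x, (pd 0 U x ^ 2 + pd 1 U x ^ 2) * (pd 0 η x ^ 2 + pd 1 η x ^ 2)) +
      ∫ x, ((η x * pd 0 κ x + κ x * pd 0 η x) ^ 2 + (η x * pd 1 κ x + κ x * pd 1 η x) ^ 2
        - deriv f (U x) * (η x * κ x) ^ 2) := by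
  set w : Euc 1 → ℝ := fun x => √(pd 0 U x ^ 2 + pd 1 U x ^ 2 + κ x ^ 2) with hwdef
  have hWpos : ∀ x, 0 < pd 0 U x ^ 2 + pd 1 U x ^ 2 + κ x ^ 2 := fun x => by
    have := hpos x
    positivity
  have u0 := hU.pd_one 0
  have u1 := hU.pd_one 1
  have hw : ContDiff ℝ 1 w :=
    (((u0.pow 2).add (u1.pow 2)).add (hκ.pow 2)).sqrt fun x => (hWpos x).ne'
  have hwpos : ∀ x, 0 < w x := fun x => Real.sqrt_pos.2 (hWpos x)
  have hwsq : ∀ x, w x ^ 2 = pd 0 U x ^ 2 + pd 1 U x ^ 2 + κ x ^ 2 := fun x =>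
    Real.sq_sqrt (hWpos x).le
  have du0 := u0.differentiable one_ne_zero
  have du1 := u1.differentiable one_ne_zero
  have dκ := hκ.differentiable one_ne_zero
  have dη := hη.differentiable one_ne_zero
  have dw := hw.differentiable one_ne_zero
  have hww' : ∀ i x, w x * pd i w x = pd 0 U x * pd i (pd 0 U) x + pd 1 U x * pd i (pd 1 U) x
      + κ x * pd i κ x := by
    intro i x
    have e : (fun y => w y * w y) =
        fun y => (pd 0 U y * pd 0 U y + pd 1 U y * pd 1 U y) + κ y * κ y := by
      funext y
      have := hwsq y
      linear_combination this
    have := congrArg (fun g => pd i g x) e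
    rw [pd_mul dw dw, pd_add ((du0.fun_mul du0).fun_add (du1.fun_mul du1)) (dκ.fun_mul dκ),
      pd_add (du0.fun_mul du0) (du1.fun_mul du1), pd_mul du0 du0, pd_mul du1 du1,
      pd_mul dκ dκ] at this
    linarith
  have hst := hstable (fun x => η x * w x) (hη.mul hw) hc.mul_right
  rw [Measure.restrict_univ] at hst
  simp only [norm_gradient_sq] at hst
  have hφ : ∀ i, ContDiff ℝ 1 (fun x => pd i U x * (η x * η x)) := fun i =>
    (hU.pd_one i).mul (hη.mul hη)
  have hφc : ∀ i, HasCompactSupport (fun x => pd i U x * (η x * η x)) := fun i =>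
    (hc.mul_left (f := η)).mul_left
  obtain ⟨n0, m0⟩ := integral_linearized_eq_zero hf hU hpde (hφ 0) (hφc 0) 0
  obtain ⟨n1, m1⟩ := integral_linearized_eq_zero hf hU hpde (hφ 1) (hφc 1) 1
  have hp : ∀ k i x, pd i (fun x => pd k U x * (η x * η x)) x =
      pd k U x * (2 * η x * pd i η x) + η x ^ 2 * pd i (pd k U) x := by
    intro k i x
    rw [pd_mul ((hU.pd_one k).differentiable one_ne_zero) (dη.fun_mul dη), pd_mul dη dη]
    ring
  have c0 := u0.continuous
  have c1 := u1.continuous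
  have cκ := hκ.continuous
  have k0 := hκ.continuous_pd 0
  have k1 := hκ.continuous_pd 1
  have j0 := hη.continuous_pd 0
  have j1 := hη.continuous_pd 1
  have cη := hη.continuous
  have cf := (hf.continuous_deriv le_rfl).comp hU.continuous
  have e1 : Integrable fun x => η x ^ 2 * defect U κ x :=
    integrable_of_cutoff hc ((cη.pow 2).mul (continuous_defect hU hκ hpos))
      (by intro x; simp +contextual)
  have e2 : Integrable fun x => (pd 0 U x ^ 2 + pd 1 U x ^ 2) * (pd 0 η x ^ 2 + pd 1 η x ^ 2) :=
    integrable_of_cutoff hc (by fun_prop) (by intro x; simp +contextual)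
  have e3 : Integrable fun x => (η x * pd 0 κ x + κ x * pd 0 η x) ^ 2 +
      (η x * pd 1 κ x + κ x * pd 1 η x) ^ 2 - deriv f (U x) * (η x * κ x) ^ 2 := by
    refine integrable_of_cutoff hc ?_ (by intro x; simp +contextual)
    exact Continuous.sub (by fun_prop) (cf.mul (by fun_prop))
  have hcong : ∀ x, pd 0 (fun x => η x * w x) x ^ 2 + pd 1 (fun x => η x * w x) x ^ 2
      - deriv f (U x) * (η x * w x) ^ 2 =
      ((pd 0 U x ^ 2 + pd 1 U x ^ 2) * (pd 0 η x ^ 2 + pd 1 η x ^ 2) +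
      ((η x * pd 0 κ x + κ x * pd 0 η x) ^ 2 +
      (η x * pd 1 κ x + κ x * pd 1 η x) ^ 2 - deriv f (U x) * (η x * κ x) ^ 2)
      - η x ^ 2 * defect U κ x) +
      ((pd 0 (pd 0 U) x * pd 0 (fun x => pd 0 U x * (η x * η x)) x +
        pd 1 (pd 0 U) x * pd 1 (fun x => pd 0 U x * (η x * η x)) x
        - deriv f (U x) * pd 0 U x * (pd 0 U x * (η x * η x))) +
      (pd 0 (pd 1 U) x * pd 0 (fun x => pd 1 U x * (η x * η x)) x +
        pd 1 (pd 1 U) x * pd 1 (fun x => pd 1 U x * (η x * η x)) x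
        - deriv f (U x) * pd 1 U x * (pd 1 U x * (η x * η x)))) := by
    intro x
    have a0 := sq_deriv_cutoff_mul_eq (η := η x) (η' := pd 0 η x) (hwsq x) (hwpos x) (hww' 0 x)
    have a1 := sq_deriv_cutoff_mul_eq (η := η x) (η' := pd 1 η x) (hwsq x) (hwpos x) (hww' 1 x)
    rw [pd_mul dη dw, pd_mul dη dw, a0, a1, mul_pow (η x) (w x), hwsq, hp, hp, hp, hp, defect,
      Fin.sum_univ_two, add_div]
    ring
  rw [integral_congr_ae (Eventually.of_forall hcong),
    integral_add (integrable_fun_sub (e2.fun_add e3) e1) (n0.fun_add n1),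
    integral_sub (e2.fun_add e3) e1, integral_add e2 e3, integral_add n0 n1, m0, m1] at hst
  linarith

/-- Smooth cutoffs at scale `R`, with gradient of order `1 / R`. -/
lemma exists_bump : ∃ C : ℝ, 0 ≤ C ∧ ∀ R : ℝ, 0 < R → ∃ χ : Euc 1 → ℝ, ContDiff ℝ 1 χ ∧
    HasCompactSupport χ ∧ (∀ x, 0 ≤ χ x ∧ χ x ≤ 1) ∧ (∀ x, ‖x‖ ≤ R → χ x = 1) ∧
    (∀ x, 2 * R ≤ ‖x‖ → χ x = 0) ∧ ∀ i x, |pd i χ x| ≤ C / R := by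
  let b : ContDiffBump (0 : Euc 1) := ⟨1, 2, one_pos, one_lt_two⟩
  have hb : ContDiff ℝ 1 b := b.contDiff
  have hbd : ∀ i : Fin 2, ∃ C, ∀ x, ‖pd i b x‖ ≤ C := fun i =>
    (hb.continuous_pd i).bounded_above_of_compact_support (b.hasCompactSupport.pd i)
  choose C hC using hbd
  have hC0 : ∀ i, 0 ≤ C i := fun i => (norm_nonneg _).trans (hC i 0)
  refine ⟨C 0 + C 1, add_nonneg (hC0 0) (hC0 1), fun R hR => ⟨fun x => b (R⁻¹ • x), ?_, ?_, ?_, ?_,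
    ?_, ?_⟩⟩
  · exact hb.comp (contDiff_const_smul R⁻¹)
  · exact b.hasCompactSupport.comp_smul (inv_ne_zero hR.ne')
  · exact fun x => ⟨b.nonneg, b.le_one⟩
  · intro x hx
    apply b.one_of_mem_closedBall
    rw [mem_closedBall_zero_iff, norm_smul, norm_inv, Real.norm_of_nonneg hR.le]
    rw [inv_mul_le_iff₀ hR]
    simpa [b] using hx
  · intro x hx
    apply b.zero_of_le_dist
    rw [dist_zero_right, norm_smul, norm_inv, Real.norm_of_nonneg hR.le, le_inv_mul_iff₀ hR]
    simp only [b]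
    linarith
  · intro i x
    have : pd i (fun x => b (R⁻¹ • x)) x = R⁻¹ * pd i b (R⁻¹ • x) := by
      have := fderiv_comp_smul (𝕜 := ℝ) (f := b) (x := x) R⁻¹
      simp [pd, this]
    rw [this, abs_mul, abs_of_pos (inv_pos.2 hR), div_eq_inv_mul]
    refine mul_le_mul_of_nonneg_left ?_ (inv_pos.2 hR).le
    have h1 := hC i (R⁻¹ • x)
    rw [Real.norm_eq_abs] at h1
    have h0 := hC0 0
    have h2 := hC0 1
    fin_cases i <;> simp at h1 ⊢ <;> linarith

lemma setIntegral_le_mul_volume {g : Euc 1 → ℝ} {B : ℝ} {R : ℝ} (hR : 0 ≤ R)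
    (hg : ∀ x, |g x| ≤ B) (h0 : ∀ x, R < ‖x‖ → g x = 0) :
    ∫ x, g x ≤ B * (R ^ 2 * volume.real (Metric.closedBall (0 : Euc 1) 1)) := by
  have h1 : ∫ x, g x = ∫ x in Metric.closedBall 0 R, g x := by
    refine (setIntegral_eq_integral_of_forall_compl_eq_zero fun x hx => h0 x ?_).symm
    simpa using hx
  have h2 := norm_setIntegral_le_of_norm_le_const (μ := (volume : Measure (Euc 1)))
    (s := Metric.closedBall (0 : Euc 1) R) (f := g) (C := B) measure_closedBall_lt_top
    (fun x _ => hg x)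
  have h3 : volume.real (Metric.closedBall (0 : Euc 1) R) =
      R ^ 2 * volume.real (Metric.closedBall (0 : Euc 1) 1) := by
    have := Measure.addHaar_real_closedBall (volume : Measure (Euc 1)) 0 hR
    have h4 := Measure.addHaar_real_closedBall (volume : Measure (Euc 1)) 0 zero_le_one
    simp at this h4
    rw [this, h4]
  rw [h1, ← h3]
  exact (le_abs_self _).trans h2

/-- A density `e` satisfying a Caccioppoli estimate has quadratic growth, so bump functions at
all scales have a uniformly bounded `e`-weighted Dirichlet energy. -/
lemma exists_bump_energy {e : Euc 1 → ℝ} (he : Continuous e) (he0 : ∀ x, 0 ≤ e x) {M : ℝ}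
    (hM : 0 ≤ M)
    (hcac : ∀ η : Euc 1 → ℝ, ContDiff ℝ 1 η → HasCompactSupport η →
      ∫ x, e x * η x ^ 2 ≤ ∫ x, (4 * (pd 0 η x ^ 2 + pd 1 η x ^ 2) + 2 * M * η x ^ 2)) :
    ∃ C : ℝ, 0 ≤ C ∧ ∀ R : ℝ, 1 ≤ R → ∃ χ : Euc 1 → ℝ, ContDiff ℝ 1 χ ∧
    HasCompactSupport χ ∧ (∀ x, 0 ≤ χ x ∧ χ x ≤ 1) ∧ (∀ x, ‖x‖ ≤ R → χ x = 1) ∧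
    (∀ x, 2 * R ≤ ‖x‖ → χ x = 0) ∧ (∀ i x, |pd i χ x| ≤ C) ∧
    ∫ x, e x * (pd 0 χ x ^ 2 + pd 1 χ x ^ 2) ≤ C := by
  obtain ⟨C, hC, H⟩ := exists_bump
  set v := volume.real (Metric.closedBall (0 : Euc 1) 1) with hv
  have hv0 : 0 ≤ v := measureReal_nonneg
  refine ⟨C + 2 * C ^ 2 * ((8 * C ^ 2 + 2 * M) * (16 * v)), by positivity, fun R hR => ?_⟩
  have hR0 : 0 < R := by linarith
  obtain ⟨χ, h1, h2, h3, h4, h5, h6⟩ := H R hR0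
  obtain ⟨ξ, g1, g2, g3, g4, g5, g6⟩ := H (2 * R) (by positivity)
  refine ⟨χ, h1, h2, h3, h4, h5, fun i x => (h6 i x).trans ?_, ?_⟩
  · have : C / R ≤ C := div_le_self hC hR
    have : 0 ≤ 2 * C ^ 2 * ((8 * C ^ 2 + 2 * M) * (16 * v)) := by positivity
    linarith
  have hsq : ∀ (i : Fin 2) (x : Euc 1), pd i χ x ^ 2 ≤ C ^ 2 / R ^ 2 := by
    intro i x
    rw [← div_pow, ← sq_abs]
    exact pow_le_pow_left₀ (abs_nonneg _) (h6 i x) 2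
  have hsqξ : ∀ (i : Fin 2) (x : Euc 1), pd i ξ x ^ 2 ≤ C ^ 2 := by
    intro i x
    rw [← sq_abs]
    refine pow_le_pow_left₀ (abs_nonneg _) ((g6 i x).trans (div_le_self hC (by linarith))) 2
  have j0 := h1.continuous_pd 0
  have j1 := h1.continuous_pd 1
  have cξ := g1.continuous
  have hpd0 : ∀ i x, 2 * R < ‖x‖ → pd i χ x = 0 := by
    intro i x hx
    have : χ =ᶠ[𝓝 x] fun _ => 0 := by
      filter_upwards [(continuous_norm.isOpen_preimage _ isOpen_Ioi).mem_nhds hx] with y hy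
      exact h5 y (le_of_lt hy)
    rw [pd_of_eventuallyEq this]
    simp [pd]
  have hpdξ : ∀ i x, 2 * (2 * R) < ‖x‖ → pd i ξ x = 0 := by
    intro i x hx
    have : ξ =ᶠ[𝓝 x] fun _ => 0 := by
      filter_upwards [(continuous_norm.isOpen_preimage _ isOpen_Ioi).mem_nhds hx] with y hy
      exact g5 y (le_of_lt hy)
    rw [pd_of_eventuallyEq this]
    simp [pd]
  have step1 : ∫ x, e x * (pd 0 χ x ^ 2 + pd 1 χ x ^ 2) ≤
      ∫ x, (2 * C ^ 2 / R ^ 2) * (e x * ξ x ^ 2) := by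
    refine integral_mono ?_ ?_ fun x => ?_
    · exact integrable_of_cutoff h2 (by fun_prop) (by intro x; simp +contextual)
    · exact integrable_of_cutoff g2 (by fun_prop) (by intro x; simp +contextual)
    · simp only
      by_cases hx : ‖x‖ ≤ 2 * R
      · rw [g4 x hx]
        have := mul_le_mul_of_nonneg_left (add_le_add (hsq 0 x) (hsq 1 x)) (he0 x)
        calc _ ≤ _ := this
          _ = _ := by ring
      · rw [hpd0 0 x (not_le.1 hx), hpd0 1 x (not_le.1 hx)]
        have := he0 x
        simp
        positivity
  have step2 := hcac ξ g1 g2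
  have step3 : ∫ x, (4 * (pd 0 ξ x ^ 2 + pd 1 ξ x ^ 2) + 2 * M * ξ x ^ 2) ≤
      (8 * C ^ 2 + 2 * M) * ((2 * (2 * R)) ^ 2 * v) := by
    refine setIntegral_le_mul_volume (by positivity) (fun x => ?_) fun x hx => ?_
    · have := g3 x
      have hξ : ξ x ^ 2 ≤ 1 := by nlinarith
      have := mul_le_mul_of_nonneg_left hξ hM
      rw [abs_of_nonneg (by positivity)]
      linarith [hsqξ 0 x, hsqξ 1 x]
    · rw [hpdξ 0 x hx, hpdξ 1 x hx, g5 x hx.le]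
      simp
  rw [integral_const_mul] at step1
  calc _ ≤ _ := step1
    _ ≤ 2 * C ^ 2 / R ^ 2 * ((8 * C ^ 2 + 2 * M) * ((2 * (2 * R)) ^ 2 * v)) :=
        mul_le_mul_of_nonneg_left (step2.trans step3) (by positivity)
    _ = 2 * C ^ 2 * ((8 * C ^ 2 + 2 * M) * (16 * v)) := by field_simp; ring
    _ ≤ _ := by linarith

/-- Sums of `N` bumps with disjointly supported gradients: plateau of height `N`, while the
weighted Dirichlet energy only grows linearly in `N`. -/
lemma exists_multiscale_cutoff {e : Euc 1 → ℝ} (he : Continuous e) (he0 : ∀ x, 0 ≤ e x) {M : ℝ}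
    (hM : 0 ≤ M)
    (hcac : ∀ η : Euc 1 → ℝ, ContDiff ℝ 1 η → HasCompactSupport η →
      ∫ x, e x * η x ^ 2 ≤ ∫ x, (4 * (pd 0 η x ^ 2 + pd 1 η x ^ 2) + 2 * M * η x ^ 2)) :
    ∃ C : ℝ, 0 ≤ C ∧ ∀ (r : ℝ) (N : ℕ), ∃ S : Euc 1 → ℝ, ContDiff ℝ 1 S ∧
    HasCompactSupport S ∧ (∀ x, 0 ≤ S x ∧ S x ≤ N) ∧ (∀ x, ‖x‖ ≤ r → S x = N) ∧
    (∀ i x, |pd i S x| ≤ C) ∧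
    ∫ x, e x * (pd 0 S x ^ 2 + pd 1 S x ^ 2) ≤ C * N := by
  obtain ⟨C, hC, H⟩ := exists_bump_energy he he0 hM hcac
  refine ⟨C, hC, fun r N => ?_⟩
  induction N with
  | zero =>
    refine ⟨fun _ => 0, contDiff_const, HasCompactSupport.zero, by simp, by simp, ?_, ?_⟩ <;>
      simp [pd, hC]
  | succ N ih =>
    obtain ⟨S, s1, s2, s3, s4, s5, s6⟩ := ih
    obtain ⟨ρ, hρ⟩ := s2.isCompact.isBounded.subset_closedBall 0
    obtain ⟨χ, h1, h2, h3, h4, h5, h6, h7⟩ := H (max 1 (max r (ρ + 1))) (le_max_left _ _)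
    set R := max 1 (max r (ρ + 1)) with hR
    have hdis : ∀ x, (∀ i, pd i S x = 0) ∨ (∀ i, pd i χ x = 0) := by
      intro x
      by_cases hx : ‖x‖ < R
      · right
        intro i
        have : χ =ᶠ[𝓝 x] fun _ => 1 := by
          filter_upwards [(continuous_norm.isOpen_preimage _ isOpen_Iio).mem_nhds hx] with y hy
          exact h4 y (le_of_lt hy)
        rw [pd_of_eventuallyEq this]
        simp [pd]
      · left
        intro i
        refine pd_eq_zero_of_notMem_tsupport (fun hmem => ?_) i
        have := hρ hmem
        rw [mem_closedBall_zero_iff] at this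
        have : ρ + 1 ≤ R := (le_max_right _ _).trans (le_max_right _ _)
        linarith
    have dS := s1.differentiable one_ne_zero
    have dχ := h1.differentiable one_ne_zero
    refine ⟨fun x => S x + χ x, s1.add h1, s2.add h2, fun x => ?_, fun x hx => ?_, fun i x => ?_,
      ?_⟩
    · have := s3 x
      have := h3 x
      push_cast
      constructor <;> linarith
    · show S x + χ x = _
      rw [s4 x hx, h4 x (hx.trans ((le_max_left _ _).trans (le_max_right _ _)))]
      push_cast
      rfl
    · rw [pd_add dS dχ]
      rcases hdis x with h | h
      · simpa [h i] using h6 i x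
      · simpa [h i] using s5 i x
    · have hsum : ∀ x, e x * (pd 0 (fun x => S x + χ x) x ^ 2 + pd 1 (fun x => S x + χ x) x ^ 2) =
          e x * (pd 0 S x ^ 2 + pd 1 S x ^ 2) + e x * (pd 0 χ x ^ 2 + pd 1 χ x ^ 2) := by
        intro x
        rw [pd_add dS dχ, pd_add dS dχ]
        rcases hdis x with h | h <;> simp [h 0, h 1]
      have a0 := s1.continuous_pd 0
      have a1 := s1.continuous_pd 1
      have b0 := h1.continuous_pd 0
      have b1 := h1.continuous_pd 1
      rw [integral_congr_ae (Eventually.of_forall hsum), integral_add]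
      · push_cast
        linarith
      · exact integrable_of_cutoff s2 (by fun_prop) (by intro x; simp +contextual)
      · exact integrable_of_cutoff h2 (by fun_prop) (by intro x; simp +contextual)

/-- A positive, square integrable weight that dominates its own gradient. -/
def weight (x : Euc 1) : ℝ := (1 + ‖x‖ ^ 2)⁻¹

lemma weight_pos (x : Euc 1) : 0 < weight x := by
  unfold weight
  positivity

lemma weight_le_one (x : Euc 1) : weight x ≤ 1 :=
  inv_le_one_of_one_le₀ (by nlinarith [sq_nonneg ‖x‖])

lemma contDiff_weight : ContDiff ℝ 1 weight :=
  (contDiff_const.add (contDiff_norm_sq ℝ)).inv fun x => by positivity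

lemma abs_pd_weight_le (i : Fin 2) (x : Euc 1) : |pd i weight x| ≤ weight x := by
  have h1 : HasFDerivAt (fun y : Euc 1 => 1 + ‖y‖ ^ 2) (2 • innerSL ℝ x) x :=
    (hasStrictFDerivAt_norm_sq x).hasFDerivAt.const_add 1
  have h2 : HasFDerivAt weight _ x :=
    (hasDerivAt_inv (by positivity : (1 + ‖x‖ ^ 2) ≠ 0)).comp_hasFDerivAt x h1
  have h3 : pd i weight x = -(weight x ^ 2) * (2 * x i) := by
    rw [pd, h2.fderiv]
    simp [weight, EuclideanSpace.inner_single_right]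
  have h4 : |x i| ≤ ‖x‖ := by
    simpa using PiLp.norm_apply_le x i
  have h5 : weight x * (2 * |x i|) ≤ 1 := by
    rw [weight, inv_mul_le_iff₀ (by positivity)]
    nlinarith [sq_nonneg (‖x‖ - 1)]
  rw [h3, abs_mul, abs_neg, abs_of_nonneg (sq_nonneg _), abs_mul, abs_two]
  have := mul_le_mul_of_nonneg_left h5 (weight_pos x).le
  linarith

lemma integrable_weight_sq : Integrable fun x => weight x ^ 2 := by
  have := integrable_rpow_neg_one_add_norm_sq (E := Euc 1) (μ := volume) (r := 4) (by simp; norm_num)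
  refine this.congr (Eventually.of_forall fun x => ?_)
  have h : (0 : ℝ) < 1 + ‖x‖ ^ 2 := by positivity
  simp only [weight]
  rw [show (-4 / 2 : ℝ) = ((-2 : ℤ) : ℝ) by norm_num, Real.rpow_intCast]
  simp [zpow_neg]

/-- Local integrals of the defect with weight `ε κ` are `O(ε²)`. -/
lemma exists_setIntegral_defect_le {f : ℝ → ℝ} (hf : ContDiff ℝ 1 f) {U : Euc 1 → ℝ}
    (hU : ContDiff ℝ 2 U) (hrange : ∀ x, U x ∈ Icc (0 : ℝ) 1)
    (hpde : ∀ x, pd 0 (pd 0 U) x + pd 1 (pd 1 U) x + f (U x) = 0)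
    (hstable : StableOn Set.univ f U) :
    ∃ C : ℝ, 0 ≤ C ∧ ∀ ε : ℝ, 0 < ε → ∀ r : ℝ,
      ∫ x in Metric.closedBall (0 : Euc 1) r, defect U (fun y => ε * weight y) x ≤ C * ε ^ 2 := by
  obtain ⟨M, hM⟩ := (isCompact_Icc (a := (0 : ℝ)) (b := 1)).exists_bound_of_continuousOn
    hf.continuous.continuousOn
  obtain ⟨L, hL⟩ := (isCompact_Icc (a := (0 : ℝ)) (b := 1)).exists_bound_of_continuousOn
    (hf.continuous_deriv le_rfl).continuousOn
  have hM0 : 0 ≤ M := (norm_nonneg _).trans (hM 0 (by simp))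
  have hL0 : 0 ≤ L := (norm_nonneg _).trans (hL 0 (by simp))
  have c0 := (hU.pd_one 0).continuous
  have c1 := (hU.pd_one 1).continuous
  obtain ⟨C, hC, H⟩ := exists_multiscale_cutoff (e := fun x => pd 0 U x ^ 2 + pd 1 U x ^ 2)
    (by fun_prop) (fun x => by positivity) hM0
    (fun η hη hc => integral_energy_le hf hU hrange hpde (fun x => hM _ (hrange x)) hη hc)
  set I := ∫ x, weight x ^ 2 with hI
  have hI0 : 0 ≤ I := integral_nonneg fun x => sq_nonneg _
  refine ⟨(2 * (1 + C) ^ 2 + L) * I, by positivity, fun ε hε r => ?_⟩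
  set κ : Euc 1 → ℝ := fun y => ε * weight y with hκdef
  have hκ : ContDiff ℝ 1 κ := contDiff_const.mul contDiff_weight
  have hκpos : ∀ x, 0 < κ x := fun x => mul_pos hε (weight_pos x)
  have hκ' : ∀ i x, |pd i κ x| ≤ κ x := by
    intro i x
    rw [hκdef, pd_const_mul (contDiff_weight.differentiable one_ne_zero), abs_mul, abs_of_pos hε]
    exact mul_le_mul_of_nonneg_left (abs_pd_weight_le i x) hε.le
  have hκint : Integrable fun x => κ x ^ 2 := by
    refine (integrable_weight_sq.const_mul (ε ^ 2)).congr (Eventually.of_forall fun x => ?_)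
    simp only [hκdef]
    ring
  have hκI : ∫ x, κ x ^ 2 = ε ^ 2 * I := by
    rw [hI, ← integral_const_mul]
    refine integral_congr_ae (Eventually.of_forall fun x => ?_)
    simp only [hκdef]
    ring
  have main : ∀ N : ℕ, 0 < N → ∫ x in Metric.closedBall (0 : Euc 1) r, defect U κ x ≤
      C / N + (2 * (1 + C) ^ 2 + L) * I * ε ^ 2 := by
    intro N hN
    have hN1 : (1 : ℝ) ≤ N := by exact_mod_cast hN
    have hN0 : (0 : ℝ) < N := by linarith
    obtain ⟨S, s1, s2, s3, s4, s5, s6⟩ := H r N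
    set η : Euc 1 → ℝ := fun x => (N : ℝ)⁻¹ * S x with hηdef
    have hη : ContDiff ℝ 1 η := contDiff_const.mul s1
    have hc : HasCompactSupport η := s2.mul_left
    have hηp : ∀ i x, pd i η x = (N : ℝ)⁻¹ * pd i S x := fun i x =>
      pd_const_mul (s1.differentiable one_ne_zero) _ i x
    have hη01 : ∀ x, |η x| ≤ 1 := by
      intro x
      rw [hηdef, abs_of_nonneg (mul_nonneg (inv_nonneg.2 hN0.le) (s3 x).1), inv_mul_le_iff₀ hN0]
      simpa using (s3 x).2
    have hηC : ∀ i x, |pd i η x| ≤ C := by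
      intro i x
      rw [hηp, abs_mul, abs_of_pos (inv_pos.2 hN0), inv_mul_le_iff₀ hN0]
      exact (s5 i x).trans (le_mul_of_one_le_left hC hN1)
    have hη1 : ∀ x, ‖x‖ ≤ r → η x = 1 := by
      intro x hx
      rw [hηdef]
      simp only
      rw [s4 x hx, inv_mul_cancel₀ hN0.ne']
    have k := integral_cutoff_defect_le hf hU hpde hstable hκ hκpos hη hc
    have t1 : ∫ x in Metric.closedBall (0 : Euc 1) r, defect U κ x ≤
        ∫ x, η x ^ 2 * defect U κ x := by
      have hint : Integrable fun x => η x ^ 2 * defect U κ x :=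
        integrable_of_cutoff hc ((hη.continuous.pow 2).mul (continuous_defect hU hκ hκpos))
          (by intro x; simp +contextual)
      have e : ∫ x in Metric.closedBall (0 : Euc 1) r, defect U κ x =
          ∫ x in Metric.closedBall (0 : Euc 1) r, η x ^ 2 * defect U κ x := by
        refine setIntegral_congr_fun measurableSet_closedBall fun x hx => ?_
        simp [hη1 x (by simpa using hx)]
      rw [e]
      exact setIntegral_le_integral hint
        (Eventually.of_forall fun x => mul_nonneg (sq_nonneg _) (defect_nonneg _ _ _))
    have t2 : ∫ x, (pd 0 U x ^ 2 + pd 1 U x ^ 2) * (pd 0 η x ^ 2 + pd 1 η x ^ 2) ≤ C / N := by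
      have e : ∀ x, (pd 0 U x ^ 2 + pd 1 U x ^ 2) * (pd 0 η x ^ 2 + pd 1 η x ^ 2) =
          ((N : ℝ)⁻¹ ^ 2) * ((pd 0 U x ^ 2 + pd 1 U x ^ 2) * (pd 0 S x ^ 2 + pd 1 S x ^ 2)) := by
        intro x
        rw [hηp, hηp]
        ring
      rw [integral_congr_ae (Eventually.of_forall e), integral_const_mul]
      calc _ ≤ (N : ℝ)⁻¹ ^ 2 * (C * N) := mul_le_mul_of_nonneg_left s6 (by positivity)
        _ = C / N := by field_simp
    have t3 : ∫ x, ((η x * pd 0 κ x + κ x * pd 0 η x) ^ 2 + (η x * pd 1 κ x + κ x * pd 1 η x) ^ 2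
        - deriv f (U x) * (η x * κ x) ^ 2) ≤ ∫ x, (2 * (1 + C) ^ 2 + L) * κ x ^ 2 := by
      refine integral_mono ?_ (hκint.const_mul _) fun x => ?_
      · have k0 := hκ.continuous_pd 0
        have k1 := hκ.continuous_pd 1
        have j0 := hη.continuous_pd 0
        have j1 := hη.continuous_pd 1
        have cη := hη.continuous
        have cκ := hκ.continuous
        have cf := (hf.continuous_deriv le_rfl).comp hU.continuous
        refine integrable_of_cutoff hc ?_ (by intro x; simp +contextual)
        exact Continuous.sub (by fun_prop) (cf.mul (by fun_prop))
      · have hb : ∀ i, (η x * pd i κ x + κ x * pd i η x) ^ 2 ≤ ((1 + C) * κ x) ^ 2 := by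
          intro i
          rw [← sq_abs]
          refine pow_le_pow_left₀ (abs_nonneg _) ?_ 2
          calc _ ≤ |η x| * |pd i κ x| + |κ x| * |pd i η x| := by
                rw [← abs_mul, ← abs_mul]
                exact abs_add_le _ _
            _ ≤ 1 * κ x + κ x * C := by
                rw [abs_of_pos (hκpos x)]
                exact add_le_add (mul_le_mul (hη01 x) (hκ' i x) (abs_nonneg _) zero_le_one)
                  (mul_le_mul_of_nonneg_left (hηC i x) (hκpos x).le)
            _ = _ := by ring
        have hf' : -deriv f (U x) * (η x * κ x) ^ 2 ≤ L * κ x ^ 2 := by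
          have h1 : -deriv f (U x) ≤ L := (neg_le_abs _).trans (hL _ (hrange x))
          have h2 : (η x * κ x) ^ 2 ≤ κ x ^ 2 := by
            rw [mul_pow]
            have : η x ^ 2 ≤ 1 := by
              rw [← sq_abs]
              exact pow_le_one₀ (abs_nonneg _) (hη01 x)
            exact mul_le_of_le_one_left (sq_nonneg _) this
          calc _ ≤ L * (η x * κ x) ^ 2 := mul_le_mul_of_nonneg_right h1 (sq_nonneg _)
            _ ≤ _ := mul_le_mul_of_nonneg_left h2 hL0
        have := hb 0
        have := hb 1
        simp only
        nlinarith
    rw [integral_const_mul, hκI] at t3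
    linarith
  have hlim : Tendsto (fun N : ℕ => C / (N : ℝ) + (2 * (1 + C) ^ 2 + L) * I * ε ^ 2) atTop
      (𝓝 (0 + (2 * (1 + C) ^ 2 + L) * I * ε ^ 2)) :=
    (tendsto_const_div_atTop_nhds_zero_nat C).add_const _
  rw [zero_add] at hlim
  exact ge_of_tendsto hlim (eventually_atTop.2 ⟨1, fun N hN => main N hN⟩)

lemma eq_zero_of_setIntegral_closedBall_nonpos {g : Euc 1 → ℝ} (hg : Continuous g)
    (h0 : ∀ x, 0 ≤ g x) (h : ∀ r : ℝ, ∫ x in Metric.closedBall (0 : Euc 1) r, g x ≤ 0)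
    (x : Euc 1) : g x = 0 := by
  have hsub : Metric.ball (0 : Euc 1) (‖x‖ + 1) ⊆ Metric.closedBall 0 (‖x‖ + 1) :=
    Metric.ball_subset_closedBall
  have hint : IntegrableOn g (Metric.closedBall (0 : Euc 1) (‖x‖ + 1)) :=
    hg.continuousOn.integrableOn_compact (isCompact_closedBall _ _)
  have h1 : ∫ y in Metric.closedBall (0 : Euc 1) (‖x‖ + 1), g y = 0 :=
    (h _).antisymm (setIntegral_nonneg measurableSet_closedBall fun y _ => h0 y)
  rw [setIntegral_eq_zero_iff_of_nonneg_ae (Eventually.of_forall h0) hint] at h1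
  have h2 := ae_restrict_of_ae_restrict_of_subset hsub h1
  exact Measure.eqOn_open_of_ae_eq h2 Metric.isOpen_ball hg.continuousOn continuousOn_const
    (show x ∈ Metric.ball (0 : Euc 1) (‖x‖ + 1) by simp)

/-- The gradient and its derivatives are collinear as soon as the defect is `O(ε²)`. -/
lemma grad_collinear_hessian {U : Euc 1 → ℝ} (hU : ContDiff ℝ 2 U) {C : ℝ}
    (hC : ∀ ε : ℝ, 0 < ε → ∀ r : ℝ,
      ∫ x in Metric.closedBall (0 : Euc 1) r, defect U (fun y => ε * weight y) x ≤ C * ε ^ 2)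
    (x : Euc 1) (j : Fin 2) : pd 0 U x * pd j (pd 1 U) x = pd 1 U x * pd j (pd 0 U) x := by
  let g : Euc 1 → ℝ := fun x =>
    (pd 0 U x * pd j (pd 1 U) x - pd 1 U x * pd j (pd 0 U) x) ^ 2 / (pd 0 U x ^ 2 + pd 1 U x ^ 2 + 1)
  have i0 := (hU.pd_one 0).continuous
  have i1 := (hU.pd_one 1).continuous
  have k0 := (hU.pd_one 0).continuous_pd j
  have k1 := (hU.pd_one 1).continuous_pd j
  have hg : Continuous g := Continuous.div (by fun_prop) (by fun_prop) fun x => by positivity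
  have hle : ∀ ε : ℝ, 0 < ε → ε ≤ 1 → ∀ x, g x ≤ defect U (fun y => ε * weight y) x := by
    intro ε hε hε1 x
    have hw := weight_pos x
    have hw1 : ε * weight x ≤ 1 := mul_le_one₀ hε1 hw.le (weight_le_one x)
    have hw2 : 0 < ε * weight x := mul_pos hε hw
    refine div_le_div₀ (Finset.sum_nonneg fun i _ => by positivity) ?_ (by positivity) ?_
    · refine le_trans ?_ (Finset.single_le_sum (fun i _ => by positivity) (Finset.mem_univ j))
      rw [add_assoc]
      exact le_add_of_nonneg_right (by positivity)
    · simp only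
      nlinarith
  have hzero : g x = 0 := by
    refine eq_zero_of_setIntegral_closedBall_nonpos hg (fun x => by positivity) (fun r => ?_) x
    have hlim : Tendsto (fun n : ℕ => C * (1 / ((n : ℝ) + 1)) ^ 2) atTop (𝓝 0) := by
      simpa using (tendsto_one_div_add_atTop_nhds_zero_nat (𝕜 := ℝ)).pow 2 |>.const_mul C
    refine ge_of_tendsto' hlim fun n => ?_
    have hn : (0 : ℝ) < 1 / ((n : ℝ) + 1) := by positivity
    refine le_trans ?_ (hC _ hn r)
    refine setIntegral_mono (hg.continuousOn.integrableOn_compact (isCompact_closedBall _ _))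
      ((continuous_defect hU (contDiff_const.mul contDiff_weight)
        fun x => mul_pos hn (weight_pos x)).continuousOn.integrableOn_compact
        (isCompact_closedBall _ _)) (hle _ hn ?_)
    rw [div_le_one (by positivity)]
    linarith [n.cast_nonneg (α := ℝ)]
  have hpos : 0 < pd 0 U x ^ 2 + pd 1 U x ^ 2 + 1 := by positivity
  have := (div_eq_zero_iff.1 hzero).resolve_right hpos.ne'
  exact sub_eq_zero.1 (pow_eq_zero_iff two_ne_zero |>.1 this)

/-- A function satisfying `|φ'| ≤ c |φ|` and vanishing at one point vanishes identically. -/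
lemma eq_zero_of_abs_deriv_le {φ φ' c : ℝ → ℝ} (hφ : ∀ s, HasDerivAt φ (φ' s) s)
    (hc : Continuous c) (h : ∀ s, |φ' s| ≤ c s * |φ s|) {a : ℝ} (ha : φ a = 0) (s : ℝ) :
    φ s = 0 := by
  have forward : ∀ {φ φ' c : ℝ → ℝ}, (∀ s, HasDerivAt φ (φ' s) s) → Continuous c →
      (∀ s, |φ' s| ≤ c s * |φ s|) → ∀ {a}, φ a = 0 → ∀ s, a ≤ s → φ s = 0 := by
    intro φ φ' c hφ hc h a ha s hs
    obtain ⟨K, hK⟩ := (isCompact_Icc (a := a) (b := s)).exists_bound_of_continuousOn hc.continuousOn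
    refine eq_zero_of_abs_deriv_le_mul_abs_self_of_eq_zero_right (f := φ) (f' := φ') (K := K)
      (fun x _ => (hφ x).continuousAt.continuousWithinAt) (fun x _ => (hφ x).hasDerivWithinAt) ha
      (fun x hx => ?_) s ⟨hs, le_rfl⟩
    exact (h x).trans (mul_le_mul_of_nonneg_right
      ((le_abs_self _).trans (hK x (Ico_subset_Icc_self hx))) (abs_nonneg _))
  rcases le_total a s with hs | hs
  · exact forward hφ hc h ha s hs
  · have h2 : ∀ s, HasDerivAt (fun s => φ (-s)) (-φ' (-s)) s := fun s => by
      have := (hφ (-s)).comp s (hasDerivAt_neg s)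
      rwa [mul_neg_one] at this
    have := forward h2 (hc.comp continuous_neg) (fun s => by simpa using h (-s)) (a := -a)
      (by simpa using ha) (-s) (neg_le_neg hs)
    simpa using this

lemma hasDerivAt_line {g : Euc 1 → ℝ} (hg : Differentiable ℝ g) (p w : Euc 1) (s : ℝ) :
    HasDerivAt (fun s : ℝ => g (p + s • w))
      (w 0 * pd 0 g (p + s • w) + w 1 * pd 1 g (p + s • w)) s := by
  have h1 : HasDerivAt (fun s : ℝ => p + s • w) w s := by
    simpa using ((hasDerivAt_id s).smul_const w).const_add p
  rw [← fderiv_apply_eq_pd]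
  exact (hg _).hasFDerivAt.comp_hasDerivAt s h1

/-- The gradient is constant along the level direction through any point. -/
lemma grad_const_on_level_line {U : Euc 1 → ℝ} (hU : ContDiff ℝ 2 U)
    (hcol : ∀ x j, pd 0 U x * pd j (pd 1 U) x = pd 1 U x * pd j (pd 0 U) x) (p : Euc 1) (s : ℝ)
    (i : Fin 2) : pd i U (p + s • !₂[-pd 1 U p, pd 0 U p]) = pd i U p := by
  set w : Euc 1 := !₂[-pd 1 U p, pd 0 U p] with hw
  have hw0 : w 0 = -pd 1 U p := by simp [hw]
  have hw1 : w 1 = pd 0 U p := by simp [hw]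
  have hd : ∀ i s, HasDerivAt (fun s : ℝ => pd i U (p + s • w))
      (w 0 * pd 0 (pd i U) (p + s • w) + w 1 * pd 1 (pd i U) (p + s • w)) s := fun i s =>
    hasDerivAt_line ((hU.pd_one i).differentiable one_ne_zero) p w s
  have hline : Continuous fun s : ℝ => p + s • w := by fun_prop
  have hH : ∀ i j, Continuous fun s : ℝ => pd j (pd i U) (p + s • w) := fun i j =>
    ((hU.pd_one i).continuous_pd j).comp hline
  have h00 := hH 0 0
  have h01 := hH 0 1
  have h11 := hH 1 1
  have key := eq_zero_of_abs_deriv_le (a := 0)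
    (φ := fun s => (pd 0 U (p + s • w) - pd 0 U p) ^ 2 + (pd 1 U (p + s • w) - pd 1 U p) ^ 2)
    (c := fun s => |pd 0 (pd 0 U) (p + s • w)| + |pd 1 (pd 1 U) (p + s • w)|
      + 2 * |pd 1 (pd 0 U) (p + s • w)|)
    (fun s => (((hd 0 s).sub_const _).pow 2).add (((hd 1 s).sub_const _).pow 2))
    (by fun_prop) (fun s => ?_) (by simp) s
  · have h0 : (pd 0 U (p + s • w) - pd 0 U p) ^ 2 = 0 := by
      nlinarith [sq_nonneg (pd 0 U (p + s • w) - pd 0 U p),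
        sq_nonneg (pd 1 U (p + s • w) - pd 1 U p)]
    have h1 : (pd 1 U (p + s • w) - pd 1 U p) ^ 2 = 0 := by
      nlinarith [sq_nonneg (pd 0 U (p + s • w) - pd 0 U p),
        sq_nonneg (pd 1 U (p + s • w) - pd 1 U p)]
    fin_cases i
    · exact sub_eq_zero.1 (pow_eq_zero_iff two_ne_zero |>.1 h0)
    · exact sub_eq_zero.1 (pow_eq_zero_iff two_ne_zero |>.1 h1)
  · have c0 := hcol (p + s • w) 0
    have c1 := hcol (p + s • w) 1
    rw [pd_symm hU 0 1] at c0 ⊢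
    rw [hw0, hw1]
    set A := pd 0 U (p + s • w)
    set B := pd 1 U (p + s • w)
    set X := pd 0 (pd 0 U) (p + s • w)
    set Y := pd 1 (pd 0 U) (p + s • w)
    set Z := pd 1 (pd 1 U) (p + s • w)
    rw [abs_of_nonneg (show 0 ≤ (A - pd 0 U p) ^ 2 + (B - pd 1 U p) ^ 2 by positivity)]
    generalize hα : A - pd 0 U p = α
    generalize hβ : B - pd 1 U p = β
    have e0 : -pd 1 U p * X + pd 0 U p * Y = β * X - α * Y := by
      rw [← hα, ← hβ]; linear_combination c0
    have e1 : -pd 1 U p * Y + pd 0 U p * Z = β * Y - α * Z := by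
      rw [← hα, ← hβ]; linear_combination c1
    rw [e0, e1]
    have b1 : |2 * α * β * X| ≤ (α ^ 2 + β ^ 2) * |X| := by
      rw [abs_mul]
      refine mul_le_mul_of_nonneg_right (abs_le.2 ⟨?_, ?_⟩) (abs_nonneg _) <;>
        nlinarith [sq_nonneg (α + β), sq_nonneg (α - β)]
    have b2 : |2 * α * β * Z| ≤ (α ^ 2 + β ^ 2) * |Z| := by
      rw [abs_mul]
      refine mul_le_mul_of_nonneg_right (abs_le.2 ⟨?_, ?_⟩) (abs_nonneg _) <;>
        nlinarith [sq_nonneg (α + β), sq_nonneg (α - β)]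
    have b3 : |(β ^ 2 - α ^ 2) * Y| ≤ (α ^ 2 + β ^ 2) * |Y| := by
      rw [abs_mul]
      refine mul_le_mul_of_nonneg_right (abs_le.2 ⟨?_, ?_⟩) (abs_nonneg _) <;>
        nlinarith [sq_nonneg α, sq_nonneg β]
    norm_num
    have b1' := abs_le.1 b1
    have b2' := abs_le.1 b2
    have b3' := abs_le.1 b3
    refine abs_le.2 ⟨?_, ?_⟩ <;> nlinarith

lemma grad_parallel {U : Euc 1 → ℝ} (hU : ContDiff ℝ 2 U)
    (hcol : ∀ x j, pd 0 U x * pd j (pd 1 U) x = pd 1 U x * pd j (pd 0 U) x) (p q : Euc 1) :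
    pd 0 U p * pd 1 U q = pd 1 U p * pd 0 U q := by
  by_contra hne
  have hD := mul_inv_cancel₀ (sub_ne_zero.2 hne)
  generalize (pd 0 U p * pd 1 U q - pd 1 U p * pd 0 U q)⁻¹ = k at hD
  have hp := grad_const_on_level_line hU hcol p
    (((q 0 - p 0) * pd 0 U q + (q 1 - p 1) * pd 1 U q) * k)
  have hq := grad_const_on_level_line hU hcol q
    (((q 0 - p 0) * pd 0 U p + (q 1 - p 1) * pd 1 U p) * k)
  have hmeet : p + (((q 0 - p 0) * pd 0 U q + (q 1 - p 1) * pd 1 U q) * k) •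
      (!₂[-pd 1 U p, pd 0 U p] : Euc 1) =
      q + (((q 0 - p 0) * pd 0 U p + (q 1 - p 1) * pd 1 U p) * k) •
      (!₂[-pd 1 U q, pd 0 U q] : Euc 1) := by
    ext i
    fin_cases i
    · simp
      linear_combination (q 0 - p 0) * hD
    · simp
      linear_combination (q 1 - p 1) * hD
  have h : ∀ i, pd i U p = pd i U q := fun i => by rw [← hp i, ← hq i, hmeet]
  apply hne
  rw [h 0, h 1, mul_comm]

/-- A solution with everywhere parallel gradients is one-dimensional. -/
lemma exists_profile {f : ℝ → ℝ} {U : Euc 1 → ℝ} (hU : ContDiff ℝ 2 U)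
    (hpde : ∀ x, pd 0 (pd 0 U) x + pd 1 (pd 1 U) x + f (U x) = 0)
    (hpar : ∀ p q, pd 0 U p * pd 1 U q = pd 1 U p * pd 0 U q)
    {p : Euc 1} (hp : pd 0 U p ^ 2 + pd 1 U p ^ 2 ≠ 0) :
    ∃ (e : Fin 2 → ℝ) (u v : ℝ → ℝ), e 0 ^ 2 + e 1 ^ 2 = 1 ∧ (∀ s, HasDerivAt u (v s) s) ∧
      (∀ s, HasDerivAt v (-f (u s)) s) ∧ (∀ x, U x = u (e 0 * x 0 + e 1 * x 1)) ∧
      (∀ i x, pd i U x = e i * v (e 0 * x 0 + e 1 * x 1)) ∧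
      ∀ i j x, pd j (pd i U) x = e i * e j * -f (u (e 0 * x 0 + e 1 * x 1)) := by
  set n : ℝ := √(pd 0 U p ^ 2 + pd 1 U p ^ 2) with hn
  have hn2 : n ^ 2 = pd 0 U p ^ 2 + pd 1 U p ^ 2 := Real.sq_sqrt (by positivity)
  have hn0 : n ≠ 0 := fun h => hp (by rw [← hn2, h]; norm_num)
  set e : Fin 2 → ℝ := fun i => pd i U p / n with he
  have he1 : e 0 ^ 2 + e 1 ^ 2 = 1 := by
    simp only [he]
    field_simp
    exact hn2.symm
  have heq : ∀ q, e 0 * pd 1 U q = e 1 * pd 0 U q := fun q => by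
    simp only [he]
    rw [div_mul_eq_mul_div, div_mul_eq_mul_div, hpar p q]
  set E : Euc 1 := !₂[e 0, e 1] with hE
  let u : ℝ → ℝ := fun s => U (s • E)
  have hu : ContDiff ℝ 2 u := hU.comp (contDiff_id.smul contDiff_const)
  have hu1 : Differentiable ℝ u := hu.differentiable two_ne_zero
  have hv1 : Differentiable ℝ (deriv u) := by
    have : ContDiff ℝ (1 + 1) u := by norm_num; exact hu
    exact (contDiff_succ_iff_deriv.1 this).2.2.differentiable one_ne_zero
  have hUu : ∀ x : Euc 1, U x = u (e 0 * x 0 + e 1 * x 1) := by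
    intro x
    set w : Euc 1 := !₂[-e 1, e 0] with hw
    have hd : ∀ s, HasDerivAt (fun s : ℝ => U ((e 0 * x 0 + e 1 * x 1) • E + s • w)) 0 s := by
      intro s
      convert hasDerivAt_line (hU.differentiable two_ne_zero) _ w s using 1
      simp [hw]
      linarith [heq ((e 0 * x 0 + e 1 * x 1) • E + s • w)]
    have hconst := is_const_of_deriv_eq_zero (fun s => (hd s).differentiableAt)
      (fun s => (hd s).deriv) (-e 1 * x 0 + e 0 * x 1) 0
    simp only [zero_smul, add_zero] at hconst
    show U x = U _
    rw [← hconst]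
    congr 1
    ext i
    fin_cases i
    · simp [hE, hw]
      linear_combination (- x 0) * he1
    · simp [hE, hw]
      linear_combination (- x 1) * he1
  have hl : Differentiable ℝ fun x : Euc 1 => e 0 * x 0 + e 1 * x 1 := by fun_prop
  have hpl : ∀ (i : Fin 2) x, pd i (fun x : Euc 1 => e 0 * x 0 + e 1 * x 1) x = e i := by
    intro i x
    have h0 : Differentiable ℝ fun x : Euc 1 => x 0 := by fun_prop
    have h1 : Differentiable ℝ fun x : Euc 1 => x 1 := by fun_prop
    have hx : ∀ i j : Fin 2, pd i (fun x : Euc 1 => x j) x = if j = i then 1 else 0 := by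
      intro i j
      have : fderiv ℝ (fun x : Euc 1 => x j) x = EuclideanSpace.proj j :=
        (EuclideanSpace.proj (𝕜 := ℝ) j).fderiv
      simp [pd, this]
    rw [pd_add (h0.const_mul _) (h1.const_mul _), pd_const_mul h0, pd_const_mul h1, hx, hx]
    fin_cases i <;> simp
  have h1 : ∀ i x, pd i U x = e i * deriv u (e 0 * x 0 + e 1 * x 1) := by
    intro i x
    rw [show U = fun x => u (e 0 * x 0 + e 1 * x 1) from funext hUu, pd_comp hu1 hl, hpl, mul_comm]
  have h2 : ∀ i j x, pd j (pd i U) x = e i * e j * deriv (deriv u) (e 0 * x 0 + e 1 * x 1) := by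
    intro i j x
    rw [show pd i U = fun x => e i * deriv u (e 0 * x 0 + e 1 * x 1) from funext (h1 i),
      pd_const_mul (g := fun x => deriv u (e 0 * x 0 + e 1 * x 1)) (hv1.comp hl), pd_comp hv1 hl, hpl]
    ring
  have h3 : ∀ s, deriv (deriv u) s = -f (u s) := by
    intro s
    have := hpde (s • E)
    rw [h2, h2] at this
    have hs : e 0 * (s • E) 0 + e 1 * (s • E) 1 = s := by
      simp [hE]
      linear_combination s * he1
    rw [hs] at this
    linear_combination this - (deriv (deriv u) s) * he1
  refine ⟨e, u, deriv u, he1, fun s => (hu1 s).hasDerivAt, fun s => ?_, hUu, h1, fun i j x => ?_⟩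
  · rw [← h3]
    exact (hv1 s).hasDerivAt
  · rw [h2, h3]

lemma volume_strip {e : Fin 2 → ℝ} (he : e 0 ^ 2 + e 1 ^ 2 = 1) (s ε δ : ℝ) :
    volume {x : Euc 1 | |e 0 * x 0 + e 1 * x 1 - s| ≤ ε ∧ |-e 1 * x 0 + e 0 * x 1| ≤ δ} =
      ENNReal.ofReal (2 * ε) * ENNReal.ofReal (2 * δ) := by
  let L : Euc 1 →ₗ[ℝ] Euc 1 :=
    { toFun := fun x => !₂[e 0 * x 0 + e 1 * x 1, -e 1 * x 0 + e 0 * x 1]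
      map_add' := fun x y => by
        ext i
        fin_cases i <;> simp <;> ring
      map_smul' := fun c x => by
        ext i
        fin_cases i <;> simp <;> ring }
  let T : Euc 1 →ₗᵢ[ℝ] Euc 1 :=
    { toLinearMap := L
      norm_map' := fun x => by
        rw [← sq_eq_sq₀ (norm_nonneg _) (norm_nonneg _), EuclideanSpace.norm_sq_eq,
          EuclideanSpace.norm_sq_eq]
        simp [L, Fin.sum_univ_two]
        linear_combination (x 0 ^ 2 + x 1 ^ 2) * he }
  have hT : MeasurePreserving (fun x : Euc 1 => (T x).ofLp) volume volume :=
    (PiLp.volume_preserving_ofLp (Fin 2)).comp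
      (T.toLinearIsometryEquiv rfl).measurePreserving
  have hset : {x : Euc 1 | |e 0 * x 0 + e 1 * x 1 - s| ≤ ε ∧ |-e 1 * x 0 + e 0 * x 1| ≤ δ} =
      (fun x : Euc 1 => (T x).ofLp) ⁻¹'
        Set.pi univ ![Icc (s - ε) (s + ε), Icc (-δ) δ] := by
    ext x
    simp [T, L, abs_le, Set.mem_pi, Fin.forall_fin_two, add_comm]
  have hm : MeasurableSet (Set.pi univ ![Icc (s - ε) (s + ε), Icc (-δ) δ]) := by
    refine MeasurableSet.univ_pi fun i => ?_
    fin_cases i <;> exact measurableSet_Icc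
  rw [hset, hT.measure_preimage hm.nullMeasurableSet, volume_pi_pi]
  rw [Fin.prod_univ_two]
  simp only [Matrix.cons_val_zero, Matrix.cons_val_one, Real.volume_Icc]
  ring_nf

/-- A one-dimensional profile has no nondegenerate critical point. -/
lemma profile_ne_zero_of_defect_le {f : ℝ → ℝ} {U : Euc 1 → ℝ} (hU : ContDiff ℝ 2 U) {C : ℝ}
    (hC : ∀ ε : ℝ, 0 < ε → ∀ r : ℝ,
      ∫ x in Metric.closedBall (0 : Euc 1) r, defect U (fun y => ε * weight y) x ≤ C * ε ^ 2)
    {e : Fin 2 → ℝ} {u v : ℝ → ℝ} (he : e 0 ^ 2 + e 1 ^ 2 = 1)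
    (hv : ∀ s, HasDerivAt v (-f (u s)) s) {M : ℝ} (hM : ∀ s, |f (u s)| ≤ M)
    (h1 : ∀ i x, pd i U x = e i * v (e 0 * x 0 + e 1 * x 1))
    (h2 : ∀ i j x, pd j (pd i U) x = e i * e j * -f (u (e 0 * x 0 + e 1 * x 1)))
    {s : ℝ} (hs : f (u s) ≠ 0) : v s ≠ 0 := by
  intro hvs
  let N : Euc 1 → ℝ := fun x => ∑ j : Fin 2,
    ((pd 0 U x * pd j weight x - weight x * pd j (pd 0 U) x) ^ 2 +
      (pd 1 U x * pd j weight x - weight x * pd j (pd 1 U) x) ^ 2)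
  have hN : Continuous N := by
    refine continuous_finsetSum _ fun j _ => ?_
    have i0 := (hU.pd_one 0).continuous
    have i1 := (hU.pd_one 1).continuous
    have k0 := (hU.pd_one 0).continuous_pd j
    have k1 := (hU.pd_one 1).continuous_pd j
    have k2 := contDiff_weight.continuous
    have k3 := contDiff_weight.continuous_pd j
    fun_prop
  let p : Euc 1 := s • !₂[e 0, e 1]
  have hp : e 0 * p 0 + e 1 * p 1 = s := by
    simp [p]
    linear_combination s * he
  have hNp : N p = weight p ^ 2 * f (u s) ^ 2 := by
    simp only [N, Fin.sum_univ_two, h1, h2, hp, hvs]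
    linear_combination (weight p ^ 2 * f (u s) ^ 2) * (e 0 ^ 2 + e 1 ^ 2 + 1) * he
  have hNpos : 0 < N p := by
    rw [hNp]
    have := weight_pos p
    positivity
  obtain ⟨ρ, hρ, hball⟩ := Metric.eventually_nhds_iff_ball.1
    (hN.continuousAt.eventually (lt_mem_nhds (half_lt_self hNpos)))
  have hvM : ∀ t, |v t| ≤ M * |t - s| := by
    intro t
    have := Convex.norm_image_sub_le_of_norm_hasDerivWithin_le (f := v) (f' := fun s => -f (u s))
      (s := univ) (C := M) (fun x _ => (hv x).hasDerivWithinAt)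
      (fun x _ => by simpa using hM x) convex_univ (mem_univ s) (mem_univ t)
    simpa [hvs] using this
  set δ := ρ / 2 with hδ
  have hδ0 : 0 < δ := half_pos hρ
  set c := N p / 2 / (M ^ 2 + 1) with hc
  have hc0 : 0 < c := by positivity
  have main : ∀ ε : ℝ, 0 < ε → ε ≤ δ → c * (2 * ε * (2 * δ)) ≤ C * ε ^ 2 := by
    intro ε hε hεδ
    let A : Set (Euc 1) :=
      {x : Euc 1 | |e 0 * x 0 + e 1 * x 1 - s| ≤ ε ∧ |-e 1 * x 0 + e 0 * x 1| ≤ δ}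
    have hA : MeasurableSet A := by
      refine (IsClosed.inter ?_ ?_).measurableSet
      · exact isClosed_le (f := fun x : Euc 1 => |e 0 * x 0 + e 1 * x 1 - s|) (by fun_prop)
          continuous_const
      · exact isClosed_le (f := fun x : Euc 1 => |-e 1 * x 0 + e 0 * x 1|) (by fun_prop)
          continuous_const
    have hAv : volume.real A = 2 * ε * (2 * δ) := by
      rw [Measure.real, volume_strip he, ENNReal.toReal_mul, ENNReal.toReal_ofReal (by positivity),
        ENNReal.toReal_ofReal (by positivity)]
    have hAball : A ⊆ Metric.ball p ρ := by
      rintro x ⟨hx1, hx2⟩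
      rw [mem_ball_iff_norm, ← sq_lt_sq₀ (norm_nonneg _) hρ.le, EuclideanSpace.norm_sq_eq]
      have hx1' := abs_le.1 (hx1.trans hεδ)
      have hx2' := abs_le.1 hx2
      have : ∑ i, ‖(x - p) i‖ ^ 2 =
          (e 0 * x 0 + e 1 * x 1 - s) ^ 2 + (-e 1 * x 0 + e 0 * x 1) ^ 2 := by
        simp [Fin.sum_univ_two, p]
        linear_combination (s ^ 2 - x 0 ^ 2 - x 1 ^ 2) * he
      rw [this]
      nlinarith
    have hAr : A ⊆ Metric.closedBall 0 (‖p‖ + ρ) := fun x hx => by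
      have := mem_ball_iff_norm.1 (hAball hx)
      rw [mem_closedBall_zero_iff]
      linarith [norm_le_norm_add_norm_sub' x p]
    have hcont := continuous_defect hU (κ := fun y => ε * weight y)
      (contDiff_const.mul contDiff_weight) fun x => mul_pos hε (weight_pos x)
    have hint : IntegrableOn (defect U fun y => ε * weight y)
        (Metric.closedBall 0 (‖p‖ + ρ)) :=
      hcont.continuousOn.integrableOn_compact (isCompact_closedBall _ _)
    have hlow : ∀ x ∈ A, c ≤ defect U (fun y => ε * weight y) x := by
      intro x hx
      have hNx : N p / 2 < N x := hball x (hAball hx)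
      have hw := weight_pos x
      have hw1 := weight_le_one x
      rw [hc, div_div, defect, div_le_div_iff₀ (by positivity) (by positivity)]
      have hnum : ε ^ 2 * N x ≤ ∑ j : Fin 2,
          ((pd 0 U x * pd j (pd 1 U) x - pd 1 U x * pd j (pd 0 U) x) ^ 2 +
          (pd 0 U x * pd j (fun y => ε * weight y) x - ε * weight x * pd j (pd 0 U) x) ^ 2 +
          (pd 1 U x * pd j (fun y => ε * weight y) x - ε * weight x * pd j (pd 1 U) x) ^ 2) := by
        simp only [N, Finset.mul_sum]
        refine Finset.sum_le_sum fun j _ => ?_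
        rw [pd_const_mul (contDiff_weight.differentiable one_ne_zero)]
        nlinarith [sq_nonneg (pd 0 U x * pd j (pd 1 U) x - pd 1 U x * pd j (pd 0 U) x)]
      have hden : pd 0 U x ^ 2 + pd 1 U x ^ 2 + (ε * weight x) ^ 2 ≤ (M ^ 2 + 1) * ε ^ 2 := by
        have e1 : pd 0 U x ^ 2 + pd 1 U x ^ 2 = v (e 0 * x 0 + e 1 * x 1) ^ 2 := by
          rw [h1, h1]
          linear_combination (v (e 0 * x 0 + e 1 * x 1) ^ 2) * he
        have e2 : |v (e 0 * x 0 + e 1 * x 1)| ≤ M * ε :=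
          (hvM _).trans (mul_le_mul_of_nonneg_left hx.1 ((abs_nonneg _).trans (hM s)))
        have e3 : v (e 0 * x 0 + e 1 * x 1) ^ 2 ≤ (M * ε) ^ 2 := sq_le_sq' (abs_le.1 e2).1
          (abs_le.1 e2).2
        have e4 : (ε * weight x) ^ 2 ≤ ε ^ 2 := by
          rw [mul_pow]
          exact mul_le_of_le_one_right (sq_nonneg _) (pow_le_one₀ hw.le hw1)
        rw [e1]
        nlinarith
      calc N p * (pd 0 U x ^ 2 + pd 1 U x ^ 2 + (ε * weight x) ^ 2)
          ≤ N p * ((M ^ 2 + 1) * ε ^ 2) := mul_le_mul_of_nonneg_left hden hNpos.le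
        _ ≤ ε ^ 2 * N x * (2 * (M ^ 2 + 1)) := by
            have : 0 ≤ (M ^ 2 + 1) * ε ^ 2 := by positivity
            nlinarith
        _ ≤ _ := mul_le_mul_of_nonneg_right hnum (by positivity)
    calc c * (2 * ε * (2 * δ)) = ∫ _ in A, c := by
          rw [setIntegral_const, hAv, smul_eq_mul, mul_comm]
      _ ≤ ∫ x in A, defect U (fun y => ε * weight y) x := by
          refine setIntegral_mono_on ?_ (hint.mono_set hAr) hA hlow
          exact integrableOn_const (volume_strip he s ε δ ▸ by finiteness)
      _ ≤ ∫ x in Metric.closedBall 0 (‖p‖ + ρ), defect U (fun y => ε * weight y) x :=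
          setIntegral_mono_set hint (Eventually.of_forall fun x => defect_nonneg _ _ x)
            hAr.eventuallyLE
      _ ≤ C * ε ^ 2 := hC ε hε _
  have hlim : Tendsto (fun ε : ℝ => C * ε) (𝓝[>] 0) (𝓝 0) :=
    (by simpa using (continuous_const_mul C).tendsto 0 :
      Tendsto (fun ε : ℝ => C * ε) (𝓝 0) (𝓝 0)).mono_left nhdsWithin_le_nhds
  have hle : c * (4 * δ) ≤ 0 := by
    refine ge_of_tendsto hlim ?_
    filter_upwards [Ioc_mem_nhdsGT hδ0] with ε hε
    have := main ε hε.1 hε.2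
    nlinarith [hε.1, this]
  nlinarith [mul_pos hc0 hδ0]

/-- Uniqueness for `u'' = -f(u)` at an equilibrium. -/
lemma profile_deriv_eq_zero {f : ℝ → ℝ} (hf : ContDiff ℝ 1 f) {u v : ℝ → ℝ}
    (hu : ∀ s, HasDerivAt u (v s) s) (hv : ∀ s, HasDerivAt v (-f (u s)) s)
    (hrange : ∀ s, u s ∈ Icc (0 : ℝ) 1) {s : ℝ} (hs : v s = 0) (hfs : f (u s) = 0) (t : ℝ) :
    v t = 0 := by
  obtain ⟨L, hL⟩ := (isCompact_Icc (a := (0 : ℝ)) (b := 1)).exists_bound_of_continuousOn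
    (hf.continuous_deriv le_rfl).continuousOn
  have hlip : ∀ r, |f (u r)| ≤ L * |u r - u s| := fun r => by
    have := Convex.norm_image_sub_le_of_norm_deriv_le
      (fun x _ => hf.differentiable one_ne_zero x) hL (convex_Icc 0 1) (hrange s) (hrange r)
    simpa [hfs] using this
  have key := eq_zero_of_abs_deriv_le (a := s) (φ := fun r => (u r - u s) ^ 2 + v r ^ 2)
    (c := fun _ => 1 + L) (fun r => (((hu r).sub_const _).pow 2).add ((hv r).pow 2))
    continuous_const (fun r => ?_) (by simp [hs]) t
  · nlinarith [sq_nonneg (u t - u s), sq_nonneg (v t)]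
  · rw [abs_of_nonneg (show 0 ≤ (u r - u s) ^ 2 + v r ^ 2 by positivity)]
    have hL0 : 0 ≤ L := (norm_nonneg _).trans (hL 0 (by simp))
    have h3 := hlip r
    have h4 : |v r * f (u r)| ≤ |v r| * (L * |u r - u s|) := by
      rw [abs_mul]
      exact mul_le_mul_of_nonneg_left h3 (abs_nonneg _)
    have h5 : |v r * (u r - u s)| = |v r| * |u r - u s| := abs_mul _ _
    have h6 := sq_abs (v r)
    have h7 := sq_abs (u r - u s)
    have h8 : 2 * (|v r| * |u r - u s|) ≤ (u r - u s) ^ 2 + v r ^ 2 := by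
      nlinarith [sq_nonneg (|v r| - |u r - u s|)]
    have h9 := abs_le.1 h4
    have h10 := abs_le.1 h5.le
    have h11 := mul_le_mul_of_nonneg_left h8 hL0
    norm_num
    refine abs_le.2 ⟨?_, ?_⟩ <;> nlinarith

lemma exists_seq_deriv_tendsto_zero {g g' : ℝ → ℝ} (hg : ∀ s, HasDerivAt g (g' s) s) {a : ℝ}
    (ha : Tendsto g atTop (𝓝 a)) :
    ∃ ξ : ℕ → ℝ, Tendsto ξ atTop atTop ∧ Tendsto (fun n => g' (ξ n)) atTop (𝓝 0) := by
  have : ∀ n : ℕ, ∃ c ∈ Ioo (n : ℝ) (n + 1), g' c = g (n + 1) - g n := fun n => by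
    obtain ⟨c, hc, h⟩ := exists_hasDerivAt_eq_slope g g' (lt_add_one (n : ℝ))
      (fun x _ => (hg x).continuousAt.continuousWithinAt) (fun x _ => hg x)
    exact ⟨c, hc, by simpa using h⟩
  choose ξ hξ h using this
  refine ⟨ξ, tendsto_atTop_mono (fun n => (hξ n).1.le) tendsto_natCast_atTop_atTop, ?_⟩
  have h1 : Tendsto (fun n : ℕ => g n) atTop (𝓝 a) := ha.comp tendsto_natCast_atTop_atTop
  have h2 : Tendsto (fun n : ℕ => g ((n : ℝ) + 1)) atTop (𝓝 a) :=
    ha.comp (tendsto_atTop_add_const_right _ 1 tendsto_natCast_atTop_atTop)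
  simpa [h] using h2.sub h1

/-- A converging solution of `u'' = -f(u)` converges to a zero of `f` at its own energy level. -/
lemma profile_limit {f F : ℝ → ℝ} (hf : Continuous f) (hF : Continuous F) {u v : ℝ → ℝ}
    (hu : ∀ s, HasDerivAt u (v s) s) (hv : ∀ s, HasDerivAt v (-f (u s)) s) {E l : ℝ}
    (hE : ∀ s, v s ^ 2 + 2 * F (u s) = E) (hl : Tendsto u atTop (𝓝 l)) :
    f l = 0 ∧ E = 2 * F l := by
  have hFl : Tendsto (fun s => 2 * F (u s)) atTop (𝓝 (2 * F l)) :=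
    ((hF.tendsto l).comp hl).const_mul 2
  have hEl : E = 2 * F l := by
    obtain ⟨ξ, hξ, h0⟩ := exists_seq_deriv_tendsto_zero hu hl
    have h1 := (h0.pow 2).add (hFl.comp hξ)
    simp only [Function.comp_def, hE] at h1
    simpa using tendsto_nhds_unique tendsto_const_nhds h1
  have hv0 : Tendsto v atTop (𝓝 0) := by
    have h1 : Tendsto (fun s => v s ^ 2) atTop (𝓝 0) := by
      have := (tendsto_const_nhds (x := E)).sub hFl
      rw [hEl, sub_self] at this
      refine this.congr fun s => ?_
      rw [← hEl, ← hE s]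
      ring
    have h2 := h1.sqrt
    simp only [Real.sqrt_sq_eq_abs, Real.sqrt_zero] at h2
    exact (tendsto_zero_iff_abs_tendsto_zero _).2 h2
  obtain ⟨ξ, hξ, h0⟩ := exists_seq_deriv_tendsto_zero hv hv0
  have h1 : Tendsto (fun n => -f (u (ξ n))) atTop (𝓝 (-f l)) :=
    (((hf.tendsto l).comp hl).comp hξ).neg
  exact ⟨neg_eq_zero.1 (tendsto_nhds_unique h1 h0), hEl⟩

lemma Bistable.eq_of_zero {f : ℝ → ℝ} {θ : ℝ} (hf : Bistable f θ) {c : ℝ} (hc : c ∈ Icc (0 : ℝ) 1)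
    (h : f c = 0) : c = 0 ∨ c = θ ∨ c = 1 := by
  by_contra! hne
  rcases lt_or_gt_of_ne hne.2.1 with h1 | h1
  · exact (hf.neg c ⟨lt_of_le_of_ne hc.1 (Ne.symm hne.1), h1⟩).ne h
  · exact (hf.pos c ⟨h1, lt_of_le_of_ne hc.2 hne.2.2⟩).ne' h

lemma Bistable.integral_neg {f : ℝ → ℝ} {θ : ℝ} (hf : Bistable f θ) :
    ∫ s in (0 : ℝ)..θ, f s < 0 := by
  have h := intervalIntegral.intervalIntegral_pos_of_pos_on (f := fun s => -f s) (a := 0) (b := θ)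
    (hf.smooth.continuous.neg.intervalIntegrable _ _)
    (fun x hx => neg_pos.2 (hf.neg x hx)) hf.θmem.1
  rw [intervalIntegral.integral_neg] at h
  linarith

lemma Bistable.no_increasing_profile {f : ℝ → ℝ} {θ : ℝ} (hf : Bistable f θ) {u v : ℝ → ℝ}
    (hu : ∀ s, HasDerivAt u (v s) s) (hv : ∀ s, HasDerivAt v (-f (u s)) s)
    (hrange : ∀ s, u s ∈ Icc (0 : ℝ) 1) (hpos : ∀ s, 0 < v s) : False := by
  let F : ℝ → ℝ := fun t => ∫ s in (0 : ℝ)..t, f s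
  have hFd : ∀ t, HasDerivAt F (f t) t := fun t =>
    (hf.smooth.continuous.integral_hasStrictDerivAt 0 t).hasDerivAt
  have hFc : Continuous F := continuous_iff_continuousAt.2 fun t => (hFd t).continuousAt
  have hF0 : F 0 = 0 := intervalIntegral.integral_same
  have hF1 : 0 < F 1 := hf.mass
  have hFθ : F θ < 0 := hf.integral_neg
  have hEd : ∀ s, HasDerivAt (fun s => v s ^ 2 + 2 * F (u s)) 0 s := fun s => by
    refine (((hv s).pow 2).add (((hFd (u s)).comp s (hu s)).const_mul 2)).congr_deriv ?_
    push_cast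
    ring
  have hE : ∀ s, v s ^ 2 + 2 * F (u s) = v 0 ^ 2 + 2 * F (u 0) := fun s =>
    is_const_of_deriv_eq_zero (fun s => (hEd s).differentiableAt) (fun s => (hEd s).deriv) s 0
  have hmono : StrictMono u := strictMono_of_deriv_pos fun s => by rw [(hu s).deriv]; exact hpos s
  have hba : BddAbove (range u) := ⟨1, by rintro _ ⟨s, rfl⟩; exact (hrange s).2⟩
  have hbb : BddBelow (range u) := ⟨0, by rintro _ ⟨s, rfl⟩; exact (hrange s).1⟩
  have htop := tendsto_atTop_ciSup hmono.monotone hba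
  have hbot := tendsto_atBot_ciInf hmono.monotone hbb
  obtain ⟨a1, a2⟩ := profile_limit hf.smooth.continuous hFc hu hv hE htop
  obtain ⟨b1, b2⟩ := profile_limit (u := fun s => u (-s)) (v := fun s => -v (-s))
    hf.smooth.continuous hFc
    (fun s => by have := (hu (-s)).comp s (hasDerivAt_neg s); rwa [mul_neg_one] at this)
    (fun s => by
      have := ((hv (-s)).comp s (hasDerivAt_neg s)).neg
      rwa [mul_neg_one, neg_neg] at this)
    (fun s => by rw [neg_sq]; exact hE (-s)) (hbot.comp tendsto_neg_atTop_atBot)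
  have hlt : ⨅ s, u s < ⨆ s, u s :=
    (ciInf_le hbb 0).trans_lt ((hmono one_pos).trans_le (le_ciSup hba 1))
  have ha := hf.eq_of_zero (isClosed_Icc.mem_of_tendsto htop (Eventually.of_forall hrange)) a1
  have hb := hf.eq_of_zero (isClosed_Icc.mem_of_tendsto hbot (Eventually.of_forall hrange)) b1
  have hFF : F (⨆ s, u s) = F (⨅ s, u s) := by linarith
  rcases ha with ha | ha | ha <;> rcases hb with hb | hb | hb <;> rw [ha, hb] at hFF hlt <;>
    first
      | exact lt_irrefl _ hlt
      | linarith

lemma Bistable.exists_profile_deriv_eq_zero {f : ℝ → ℝ} {θ : ℝ} (hf : Bistable f θ) {u v : ℝ → ℝ}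
    (hu : ∀ s, HasDerivAt u (v s) s) (hv : ∀ s, HasDerivAt v (-f (u s)) s)
    (hrange : ∀ s, u s ∈ Icc (0 : ℝ) 1) : ∃ s, v s = 0 := by
  by_contra! hne
  have hvc : Continuous v := continuous_iff_continuousAt.2 fun s => (hv s).continuousAt
  have hsign : (∀ s, 0 < v s) ∨ ∀ s, v s < 0 := by
    by_contra! h
    obtain ⟨⟨a, ha⟩, b, hb⟩ := h
    obtain ⟨c, hc⟩ := mem_range_of_exists_le_of_exists_ge hvc ⟨a, ha⟩ ⟨b, hb⟩
    exact hne c hc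
  rcases hsign with h | h
  · exact hf.no_increasing_profile hu hv hrange h
  · refine hf.no_increasing_profile (u := fun s => u (-s)) (v := fun s => -v (-s)) (fun s => ?_)
      (fun s => ?_) (fun s => hrange (-s)) (fun s => neg_pos.2 (h _))
    · have := (hu (-s)).comp s (hasDerivAt_neg s)
      rwa [mul_neg_one] at this
    · have := ((hv (-s)).comp s (hasDerivAt_neg s)).neg
      rwa [mul_neg_one, neg_neg] at this

/-- A constant at which `f` has positive slope is not stable in the whole plane. -/
lemma not_stableOn_const {f : ℝ → ℝ} {c : ℝ} (hc : 0 < deriv f c) :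
    ¬ StableOn Set.univ f (fun _ : Euc 1 => c) := by
  intro hst
  obtain ⟨C, hC, H⟩ := exists_bump
  set R := (8 * C ^ 2 + 1) / deriv f c + 1 with hR
  have hR1 : 1 ≤ R := le_add_of_nonneg_left (by positivity)
  have hR0 : 0 < R := one_pos.trans_le hR1
  obtain ⟨χ, h1, h2, h3, h4, h5, h6⟩ := H R hR0
  have hst := hst χ h1 h2
  have p0 := h1.continuous_pd 0
  have p1 := h1.continuous_pd 1
  have cχ := h1.continuous
  have i1 : Integrable fun x => pd 0 χ x ^ 2 + pd 1 χ x ^ 2 :=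
    integrable_of_cutoff h2 (by fun_prop) fun x _ a b => by simp [a, b]
  have i2 : Integrable fun x => χ x ^ 2 :=
    integrable_of_cutoff h2 (by fun_prop) fun x a _ _ => by simp [a]
  have hvol : 0 < volume.real (Metric.closedBall (0 : Euc 1) 1) :=
    ENNReal.toReal_pos (Metric.measure_closedBall_pos _ _ one_pos).ne'
      measure_closedBall_lt_top.ne
  simp only [norm_gradient_sq, setIntegral_univ] at hst
  rw [integral_sub i1 (i2.const_mul _), integral_const_mul] at hst
  have hup : ∫ x, (pd 0 χ x ^ 2 + pd 1 χ x ^ 2) ≤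
      2 * (C / R) ^ 2 * ((2 * R) ^ 2 * volume.real (Metric.closedBall (0 : Euc 1) 1)) := by
    refine setIntegral_le_mul_volume (by positivity) (fun x => ?_) fun x hx => ?_
    · rw [abs_of_nonneg (by positivity), ← sq_abs (pd 0 χ x), ← sq_abs (pd 1 χ x)]
      have a := pow_le_pow_left₀ (abs_nonneg _) (h6 0 x) 2
      have b := pow_le_pow_left₀ (abs_nonneg _) (h6 1 x) 2
      linarith
    · have hev : χ =ᶠ[𝓝 x] fun _ => 0 := by
        filter_upwards [(isOpen_lt continuous_const continuous_norm).mem_nhds hx] with y hy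
        exact h5 y (le_of_lt hy)
      rw [pd_of_eventuallyEq hev, pd_of_eventuallyEq hev]
      simp [pd]
  have hlow : R ^ 2 * volume.real (Metric.closedBall (0 : Euc 1) 1) ≤ ∫ x, χ x ^ 2 := by
    have hball : volume.real (Metric.closedBall (0 : Euc 1) R) =
        R ^ 2 * volume.real (Metric.closedBall (0 : Euc 1) 1) := by
      rw [Measure.addHaar_real_closedBall' _ _ hR0.le]
      simp
    rw [← hball]
    calc volume.real (Metric.closedBall (0 : Euc 1) R)
        = ∫ x in Metric.closedBall (0 : Euc 1) R, χ x ^ 2 := by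
          rw [setIntegral_congr_fun measurableSet_closedBall (g := fun _ => (1 : ℝ))
            fun x hx => by simp [h4 x (mem_closedBall_zero_iff.1 hx)]]
          simp
      _ ≤ ∫ x, χ x ^ 2 := setIntegral_le_integral i2 (Eventually.of_forall fun x => sq_nonneg _)
  have hup' : 2 * (C / R) ^ 2 * ((2 * R) ^ 2 * volume.real (Metric.closedBall (0 : Euc 1) 1)) =
      8 * C ^ 2 * volume.real (Metric.closedBall (0 : Euc 1) 1) := by
    field_simp
    ring
  have hRc : 8 * C ^ 2 + 1 ≤ deriv f c * R ^ 2 := by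
    have : deriv f c * R = 8 * C ^ 2 + 1 + deriv f c := by
      rw [hR]
      field_simp
    nlinarith
  have := mul_le_mul_of_nonneg_left hlow hc.le
  nlinarith

/-- Proposition 3.4: a stable solution `0 ≤ U ≤ 1` of `ΔU + f(U) = 0`
in the plane `ℝ²` is identically `0` or identically `1`. -/
theorem statement12 (f : ℝ → ℝ) (θ : ℝ) (hf : Bistable f θ)
    (U : Euc 1 → ℝ) (hU : ContDiff ℝ 2 U)
    (hrange : ∀ x : Euc 1, U x ∈ Icc (0 : ℝ) 1)
    (hpde : ∀ x : Euc 1, lapW Set.univ U x + f (U x) = 0)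
    (hstable : StableOn Set.univ f U) :
    (∀ x : Euc 1, U x = 0) ∨ (∀ x : Euc 1, U x = 1) := by
  have hpde' : ∀ x, pd 0 (pd 0 U) x + pd 1 (pd 1 U) x + f (U x) = 0 := fun x => by
    rw [← lapW_univ]
    exact hpde x
  obtain ⟨C, -, hC⟩ := exists_setIntegral_defect_le hf.smooth hU hrange hpde' hstable
  have hpar := grad_parallel hU (grad_collinear_hessian hU hC)
  by_cases hV : ∀ x, pd 0 U x ^ 2 + pd 1 U x ^ 2 = 0
  · have hpd : ∀ x (i : Fin 2), pd i U x = 0 := fun x i => by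
      have h0 : pd 0 U x = 0 := by nlinarith [hV x]
      have h1 : pd 1 U x = 0 := by nlinarith [hV x]
      fin_cases i
      exacts [h0, h1]
    have hconst : ∀ x, U x = U 0 := fun x =>
      is_const_of_fderiv_eq_zero (hU.differentiable two_ne_zero)
        (fun y => by ext w; simp [fderiv_apply_eq_pd, hpd]) x 0
    have hz : f (U 0) = 0 := by
      have h2 : ∀ i : Fin 2, pd i (pd i U) 0 = 0 := fun i => by
        rw [show pd i U = fun _ => 0 from funext fun x => hpd x i]
        simp [pd]
      simpa [h2] using hpde' 0
    rcases hf.eq_of_zero (hrange 0) hz with h | h | h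
    · exact Or.inl fun x => (hconst x).trans h
    · rw [show U = fun _ => θ from funext fun x => (hconst x).trans h] at hstable
      exact absurd hstable (not_stableOn_const hf.dθ)
    · exact Or.inr fun x => (hconst x).trans h
  · push Not at hV
    obtain ⟨p, hp⟩ := hV
    obtain ⟨e, u, v, he, hu, hv, hUu, h1, h2⟩ := exists_profile hU hpde' hpar hp
    have hurange : ∀ s, u s ∈ Icc (0 : ℝ) 1 := fun s => by
      have h := hrange (s • !₂[e 0, e 1])
      have hs : e 0 * (s • !₂[e 0, e 1] : Euc 1) 0 + e 1 * (s • !₂[e 0, e 1] : Euc 1) 1 = s := by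
        simp
        linear_combination s * he
      rwa [hUu, hs] at h
    obtain ⟨M, hM⟩ := (isCompact_Icc (a := (0 : ℝ)) (b := 1)).exists_bound_of_continuousOn
      hf.smooth.continuous.continuousOn
    obtain ⟨s, hs⟩ := hf.exists_profile_deriv_eq_zero hu hv hurange
    by_cases hfs : f (u s) = 0
    · have hv0 := profile_deriv_eq_zero hf.smooth hu hv hurange hs hfs
      exact absurd (by simp [h1, hv0]) hp
    · exact absurd hs (profile_ne_zero_of_defect_le hU hC he hv (fun s => hM _ (hurange s))
        h1 h2 hfs)
end
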